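/- There is a universal constant M ≤ 5.6 such that for every complex Hilbert space H, every bounded linear operator T on H, every n ≥ 1, and every n×n matrix polynomial F, one has w(F(T)) ≤ M · ‖F‖_{W(T)}. -/

import Mathlib

open scoped InnerProductSpace
open ContinuousLinearMap Polynomial

noncomputable section

/-- The numerical radius `w(X) = sup { |⟨X x, x⟩| : ‖x‖ = 1 }` of a bounded operator
on a complex inner product space. (Here `⟪x, X x⟫_ℂ` is the mathematicians'
`⟨X x, x⟩`, since Mathlib's inner product is conjugate-linear in the first slot.) -/
def numRadius {E : Type*} [NormedAddCommGroup E] [InnerProductSpace ℂ E]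
    (X : E →L[ℂ] E) : ℝ :=
  sSup {r : ℝ | ∃ x : E, ‖x‖ = 1 ∧ r = ‖(⟪x, X x⟫_ℂ : ℂ)‖}

/-- The numerical range `W(X) = { ⟨X x, x⟩ : ‖x‖ = 1 }` of a bounded operator
on a complex inner product space. (Here `⟪x, X x⟫_ℂ` is the mathematicians'
`⟨X x, x⟩`, since Mathlib's inner product is conjugate-linear in the first slot.) -/
def numRange {E : Type*} [NormedAddCommGroup E] [InnerProductSpace ℂ E]
    (X : E →L[ℂ] E) : Set ℂ :=
  {z : ℂ | ∃ x : E, ‖x‖ = 1 ∧ z = ⟪x, X x⟫_ℂ}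

/-- The 2×2 block operator `[[A, B], [C, D]]` acting on the Hilbert space
direct sum `H ⊕₂ H`. -/
def blockOp {H : Type*} [NormedAddCommGroup H] [InnerProductSpace ℂ H]
    (A B C D : H →L[ℂ] H) : WithLp 2 (H × H) →L[ℂ] WithLp 2 (H × H) :=
  ((WithLp.prodContinuousLinearEquiv 2 ℂ H H).symm :
      (H × H) →L[ℂ] WithLp 2 (H × H)) ∘L
    ((A ∘L fst ℂ H H + B ∘L snd ℂ H H).prod (C ∘L fst ℂ H H + D ∘L snd ℂ H H)) ∘L
    ((WithLp.prodContinuousLinearEquiv 2 ℂ H H) : WithLp 2 (H × H) →L[ℂ] (H × H))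

/-- Evaluation of an `n × n` matrix polynomial `F = (p_{ij})` at an operator `T`:
the block operator `(p_{ij}(T))` acting on the `n`-fold Hilbert direct sum `Hⁿ`. -/
def matPolyEval {H : Type*} [NormedAddCommGroup H] [InnerProductSpace ℂ H]
    {n : ℕ} (T : H →L[ℂ] H)
    (F : Matrix (Fin n) (Fin n) (Polynomial ℂ)) :
    (PiLp 2 fun _ : Fin n => H) →L[ℂ] (PiLp 2 fun _ : Fin n => H) :=
  ((PiLp.continuousLinearEquiv 2 ℂ fun _ : Fin n => H).symm :
      (Fin n → H) →L[ℂ] PiLp 2 fun _ : Fin n => H) ∘L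
    (pi fun i => ∑ j, (aeval T (F i j)) ∘L proj j) ∘L
    ((PiLp.continuousLinearEquiv 2 ℂ fun _ : Fin n => H) :
      (PiLp 2 fun _ : Fin n => H) →L[ℂ] (Fin n → H))

/-- The supremum norm `‖F‖_K = sup_{z ∈ K} ‖F(z)‖` of an `n × n` matrix polynomial
over a set `K ⊆ ℂ`, where `‖F(z)‖` is the operator norm of the matrix `F(z)` on `ℂⁿ`. -/
def matPolyNorm {n : ℕ} (K : Set ℂ) (F : Matrix (Fin n) (Fin n) (Polynomial ℂ)) : ℝ :=
  sSup {r : ℝ | ∃ z ∈ K, r = ‖Matrix.toEuclideanCLM (𝕜 := ℂ) (F.map (Polynomial.eval z))‖}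

universe u

section OperatorSpectralSets

open MeasureTheory Set Filter Topology ComplexConjugate

theorem LocallyLipschitz.contDiffAt_comp {X E F : Type*} [PseudoMetricSpace X]
    [NormedAddCommGroup E] [NormedSpace ℝ E] [NormedAddCommGroup F] [NormedSpace ℝ F]
    {f : X → E} {g : E → F} (hf : LocallyLipschitz f) (hg : ∀ x, ContDiffAt ℝ 1 g (f x)) :
    LocallyLipschitz fun x => g (f x) := by
  intro x
  obtain ⟨K, s, hs, hK⟩ := (hg x).exists_lipschitzOnWith
  obtain ⟨L, t, ht, hL⟩ := hf x
  refine ⟨K * L, t ∩ f ⁻¹' s, inter_mem ht (hf.continuous.continuousAt hs), ?_⟩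
  exact hK.comp (hL.mono inter_subset_left) fun y hy => hy.2

/-- The derivative of a periodic locally Lipschitz function has integral zero over a period. -/
theorem integral_eq_zero_of_periodic_of_locallyLipschitz {E : Type*} [NormedAddCommGroup E]
    [NormedSpace ℝ E] {f f' : ℝ → E} {T : ℝ} (hT : 0 < T) (hf : LocallyLipschitz f)
    (hper : Function.Periodic f T) (hf' : ∀ᵐ t, HasDerivAt f (f' t) t) :
    ∫ t in (0 : ℝ)..T, f' t = 0 := by
  obtain ⟨K, hK⟩ := (hf.locallyLipschitzOn (s := Icc 0 (T + 1))).exists_lipschitzOnWith_of_compact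
    isCompact_Icc
  let h : ℕ → ℝ := fun n => 1 / ((n : ℝ) + 1)
  have hpos : ∀ n, 0 < h n := fun n => Nat.one_div_pos_of_nat
  have hle : ∀ n, h n ≤ 1 := fun n => by
    simp only [h]
    rw [div_le_one (by positivity)]
    have : (0 : ℝ) ≤ n := by positivity
    linarith
  have hlim : Tendsto h atTop (𝓝[≠] 0) := by
    refine tendsto_nhdsWithin_iff.mpr ⟨tendsto_one_div_add_atTop_nhds_zero_nat, ?_⟩
    exact Eventually.of_forall fun n => (hpos n).ne'
  have hcont := hf.continuous
  have key : Tendsto (fun n => ∫ t in (0 : ℝ)..T, (h n)⁻¹ • (f (t + h n) - f t)) atTop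
      (𝓝 (∫ t in (0 : ℝ)..T, f' t)) := by
    refine intervalIntegral.tendsto_integral_filter_of_dominated_convergence (fun _ => (K : ℝ))
      ?_ ?_ (by simp) ?_
    · exact Eventually.of_forall fun n => by
        apply Continuous.aestronglyMeasurable
        fun_prop
    · refine Eventually.of_forall fun n => Eventually.of_forall fun t ht => ?_
      rw [uIoc_of_le hT.le] at ht
      have := hK.norm_sub_le (x := t + h n) (y := t)
        ⟨by linarith [ht.1, hpos n], by linarith [ht.2, hle n]⟩ ⟨ht.1.le, by linarith [ht.2]⟩
      rw [norm_smul, norm_inv, Real.norm_of_nonneg (hpos n).le, inv_mul_le_iff₀ (hpos n)]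
      rw [add_sub_cancel_left, Real.norm_of_nonneg (hpos n).le] at this
      linarith
    · filter_upwards [hf'] with t ht _
      exact ht.tendsto_slope_zero.comp hlim
  have hzero : ∀ n, ∫ t in (0 : ℝ)..T, (h n)⁻¹ • (f (t + h n) - f t) = 0 := by
    intro n
    rw [intervalIntegral.integral_smul, intervalIntegral.integral_sub
      (by apply Continuous.intervalIntegrable; fun_prop) (hcont.intervalIntegrable _ _),
      intervalIntegral.integral_comp_add_right]
    have := hper.intervalIntegral_add_eq (h n) 0
    simp only [zero_add] at this ⊢
    rw [add_comm T, this, sub_self, smul_zero]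
  simp only [hzero] at key
  exact (tendsto_nhds_unique key tendsto_const_nhds)

/-- A counterclockwise closed curve, inside a convex set `Ω ⊆ ℂ` with `0` in its interior, at every
point of which `Ω` has a supporting line, this line being tangent to the curve almost everywhere. -/
structure SupportedCurve (Ω : Set ℂ) where
  /-- The parametrisation of the curve. -/
  pt : ℝ → ℂ
  /-- Its derivative. -/
  vel : ℝ → ℂ
  /-- The unit outward normal of the supporting line. -/
  normal : ℝ → ℂ
  /-- A lower bound for the distance from `0` to the supporting lines. -/
  gap : ℝ
  locallyLipschitz : LocallyLipschitz pt
  periodic : Function.Periodic pt (2 * Real.pi)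
  intervalIntegrable : IntervalIntegrable vel volume 0 (2 * Real.pi)
  hasDerivAt : ∀ᵐ t, HasDerivAt pt (vel t) t
  mem : ∀ t, pt t ∈ Ω
  gap_pos : 0 < gap
  norm_normal : ∀ t, ‖normal t‖ = 1
  support : ∀ t, ∀ z ∈ Ω, (conj (normal t) * z).re ≤ (conj (normal t) * pt t).re
  gap_le : ∀ t, gap ≤ (conj (normal t) * pt t).re
  tangent : ∀ᵐ t, ∃ c : ℝ, 0 ≤ c ∧ vel t = c * Complex.I * normal t
  winding : ∫ t in (0 : ℝ)..2 * Real.pi, vel t / pt t = 2 * Real.pi * Complex.I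

/-- A continuous real linear functional on `ℂ` is `z ↦ Re (conj ν * z)` for some `ν`. -/
theorem exists_re_conj_mul_eq (f : ℂ →L[ℝ] ℝ) : ∃ ν : ℂ, ∀ z, f z = (conj ν * z).re := by
  refine ⟨⟨f 1, f Complex.I⟩, fun z => ?_⟩
  have : z = z.re • (1 : ℂ) + z.im • Complex.I := by
    apply Complex.ext <;> simp
  conv_lhs => rw [this]
  simp only [map_add, map_smul, Complex.mul_re, Complex.conj_re, Complex.conj_im, smul_eq_mul]
  ring

theorem exists_unit_normal {Ω : Set ℂ} (hconv : Convex ℝ Ω) (h0 : (0 : ℂ) ∈ interior Ω) {s : ℂ}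
    (hs : s ∉ interior Ω) :
    ∃ ν : ℂ, ‖ν‖ = 1 ∧ ∀ z ∈ Ω, (conj ν * z).re ≤ (conj ν * s).re := by
  obtain ⟨f, hf⟩ := geometric_hahn_banach_open_point hconv.interior isOpen_interior hs
  obtain ⟨ν, hν⟩ := exists_re_conj_mul_eq f
  have hν0 : ν ≠ 0 := by
    rintro rfl
    have := hf 0 h0
    simp [hν] at this
  have hle : ∀ z ∈ Ω, f z ≤ f s := by
    intro z hz
    have hz' : z ∈ closure (interior Ω) := by
      rw [hconv.closure_interior_eq_closure_of_nonempty_interior ⟨0, h0⟩]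
      exact subset_closure hz
    exact closure_minimal (t := {z | f z ≤ f s}) (fun a ha => (hf a ha).le)
      (isClosed_le f.continuous continuous_const) hz'
  refine ⟨(‖ν‖⁻¹ : ℝ) * ν, ?_, fun z hz => ?_⟩
  · rw [norm_mul, Complex.norm_real, norm_inv, norm_norm, inv_mul_cancel₀ (norm_ne_zero_iff.2 hν0)]
  · have := hle z hz
    rw [hν, hν] at this
    rw [map_mul, Complex.conj_ofReal, mul_assoc, mul_assoc, Complex.re_ofReal_mul,
      Complex.re_ofReal_mul]
    gcongr

theorem SupportedCurve.exists_of_convex {Ω : Set ℂ} (hconv : Convex ℝ Ω) (hcomp : IsCompact Ω)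
    (h0 : (0 : ℂ) ∈ interior Ω) : Nonempty (SupportedCurve Ω) := by
  have hnhds : Ω ∈ 𝓝 (0 : ℂ) := mem_interior_iff_mem_nhds.1 h0
  have habs : Absorbent ℝ Ω := absorbent_nhds_zero hnhds
  obtain ⟨K, hK⟩ := hconv.lipschitz_gauge hnhds
  let e : ℝ → ℂ := fun t => Complex.exp (t * Complex.I)
  have he : ∀ t, HasDerivAt e (e t * Complex.I) t := fun t => by
    have := ((hasDerivAt_id (t : ℂ)).mul_const Complex.I).cexp.comp_ofReal
    simpa [e] using this
  have he0 : ∀ t, e t ≠ 0 := fun t => Complex.exp_ne_zero _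
  have hne : ∀ t, ‖e t‖ = 1 := fun t => Complex.norm_exp_ofReal_mul_I t
  have heC : ContDiff ℝ 1 e := by
    simp only [e]
    exact (Complex.ofRealCLM.contDiff.mul contDiff_const).cexp
  have heL : LipschitzWith 1 e := by
    refine lipschitzWith_of_nnnorm_deriv_le (fun t => (he t).differentiableAt) fun t => ?_
    rw [(he t).deriv, ← NNReal.coe_le_coe]
    simp [hne]
  have heper : Function.Periodic e (2 * Real.pi) := fun t => by
    simp only [e]
    push_cast
    rw [add_mul, Complex.exp_add, Complex.exp_two_pi_mul_I, mul_one]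
  let q : ℝ → ℝ := fun t => gauge Ω (e t)
  have hqL : LipschitzWith (K * 1) q := hK.comp heL
  have hqper : Function.Periodic q (2 * Real.pi) := fun t => by simp only [q, heper t]
  obtain ⟨R, hR0, hR⟩ := hcomp.isBounded.subset_closedBall_lt 0 (0 : ℂ)
  have hqlow : ∀ t, R⁻¹ ≤ q t := fun t => by
    have := le_gauge_of_subset_closedBall habs hR0.le hR (x := e t)
    rwa [hne, one_div] at this
  have hqpos : ∀ t, 0 < q t := fun t => (inv_pos.2 hR0).trans_le (hqlow t)
  let p : ℝ → ℂ := fun t => e t / (q t : ℂ)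
  have hqC : ∀ t, (q t : ℂ) ≠ 0 := fun t => Complex.ofReal_ne_zero.2 (hqpos t).ne'
  have hp0 : ∀ t, p t ≠ 0 := fun t => div_ne_zero (he0 t) (hqC t)
  have hpsmul : ∀ t, p t = (q t)⁻¹ • e t := fun t => by
    simp only [p, Complex.real_smul, Complex.ofReal_inv]
    rw [div_eq_inv_mul]
  have hgauge : ∀ t, gauge Ω (p t) = 1 := fun t => by
    rw [hpsmul, gauge_smul_of_nonneg (inv_nonneg.2 (hqpos t).le), smul_eq_mul]
    exact inv_mul_cancel₀ (hqpos t).ne'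
  have hpnot : ∀ t, p t ∉ interior Ω := fun t h => by
    have := (gauge_lt_one_iff_mem_interior hconv hnhds).2 h
    rw [hgauge] at this
    exact lt_irrefl _ this
  have hpmem : ∀ t, p t ∈ Ω := fun t => by
    have := (gauge_le_one_iff_mem_closure hconv hnhds (x := p t)).1 (hgauge t).le
    rwa [hcomp.isClosed.closure_eq] at this
  choose ν hν1 hν using fun t => exists_unit_normal hconv h0 (hpnot t)
  obtain ⟨η, hη, hball⟩ := Metric.nhds_basis_closedBall.mem_iff.1 hnhds
  have hgap : ∀ t, η ≤ (conj (ν t) * p t).re := fun t => by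
    have := hν t (η * ν t) (hball (by simp [hν1, abs_of_pos hη]))
    rw [mul_left_comm, Complex.conj_mul', hν1] at this
    simpa using this
  have hpL : LocallyLipschitz p := by
    have h1 : LocallyLipschitz fun t => (t, q t) :=
      LocallyLipschitz.id.prodMk hqL.locallyLipschitz
    refine h1.contDiffAt_comp (g := fun x : ℝ × ℝ => e x.1 / (x.2 : ℂ)) fun t => ?_
    simp only [div_eq_mul_inv]
    refine ContDiffAt.mul ?_ (ContDiffAt.inv ?_ (hqC t))
    · exact (heC.comp contDiff_fst).contDiffAt
    · exact (Complex.ofRealCLM.contDiff.comp contDiff_snd).contDiffAt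
  let v : ℝ → ℂ := fun t => p t * (Complex.I - (deriv q t / q t : ℝ))
  have hqd : ∀ᵐ t, HasDerivAt q (deriv q t) t := by
    filter_upwards [hqL.ae_differentiableAt_real] with t ht using ht.hasDerivAt
  have hpd : ∀ᵐ t, HasDerivAt p (v t) t := by
    filter_upwards [hqd] with t ht
    have := (he t).div ht.ofReal_comp (hqC t)
    refine this.congr_deriv ?_
    simp only [v, p]
    have := hqC t
    push_cast
    field_simp
  have hlog : ∫ t in (0 : ℝ)..2 * Real.pi, deriv q t / q t = 0 := by
    refine integral_eq_zero_of_periodic_of_locallyLipschitz (f := fun t => Real.log (q t))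
      Real.two_pi_pos ?_ (fun t => by simp only [hqper t]) ?_
    · exact hqL.locallyLipschitz.contDiffAt_comp fun t => Real.contDiffAt_log.2 (hqpos t).ne'
    · filter_upwards [hqd] with t ht using ht.log (hqpos t).ne'
  have hint : IntervalIntegrable (fun t => (deriv q t / q t : ℝ)) volume 0 (2 * Real.pi) := by
    refine (intervalIntegrable_const (c := (K * 1 : NNReal) * R)).mono_fun ?_ ?_
    · exact ((measurable_deriv q).div hqL.continuous.measurable).aestronglyMeasurable
    · refine Eventually.of_forall fun t => ?_
      beta_reduce
      refine le_trans ?_ (Real.le_norm_self _)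
      rw [norm_div, div_eq_mul_inv, Real.norm_of_nonneg (hqpos t).le]
      exact mul_le_mul (norm_deriv_le_of_lipschitz hqL) (inv_le_of_inv_le₀ hR0 (hqlow t))
        (inv_nonneg.2 (hqpos t).le) (NNReal.coe_nonneg _)
  have hintC : IntervalIntegrable (fun t => ((deriv q t / q t : ℝ) : ℂ)) volume 0
      (2 * Real.pi) := ⟨Integrable.ofReal hint.1, Integrable.ofReal hint.2⟩
  have hint2 : IntervalIntegrable (fun t => Complex.I - ((deriv q t / q t : ℝ) : ℂ)) volume 0
      (2 * Real.pi) := intervalIntegrable_const.sub hintC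
  refine ⟨⟨p, v, ν, η, hpL, fun t => by simp only [p, heper t, hqper t], ?_, hpd, hpmem, hη, hν1,
    hν, hgap, ?_, ?_⟩⟩
  · exact hint2.continuousOn_mul hpL.continuous.continuousOn
  · filter_upwards [hpd] with t ht
    have hmax : IsLocalMax (fun s => (conj (ν t) * p s).re) t :=
      Eventually.of_forall fun s => hν t _ (hpmem s)
    have hd : HasDerivAt (fun s => (conj (ν t) * p s).re) (conj (ν t) * v t).re t :=
      (Complex.reCLM.hasFDerivAt.comp_hasDerivAt t (ht.const_mul (conj (ν t))))
    have hre := hmax.hasDerivAt_eq_zero hd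
    refine ⟨(conj (ν t) * v t).im, ?_, ?_⟩
    · have hpos := hη.trans_le (hgap t)
      simp only [v] at hre ⊢
      rw [← mul_assoc] at hre ⊢
      generalize conj (ν t) * p t = w at hre hpos ⊢
      generalize deriv q t / q t = d at hre ⊢
      simp only [Complex.mul_re, Complex.mul_im, Complex.sub_re, Complex.sub_im, Complex.I_re,
        Complex.I_im, Complex.ofReal_re, Complex.ofReal_im] at hre ⊢
      have : w.im = -(w.re * d) := by linarith
      rw [this]
      nlinarith [mul_nonneg hpos.le (sq_nonneg d)]
    · have h1 : conj (ν t) * v t = ((conj (ν t) * v t).im : ℂ) * Complex.I := by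
        apply Complex.ext
        · rw [hre]; simp
        · simp
      rw [← h1, mul_right_comm, Complex.conj_mul', hν1]
      simp
  · have : ∀ t, v t / p t = Complex.I - ((deriv q t / q t : ℝ) : ℂ) := fun t => by
      simp only [v]
      rw [mul_div_cancel_left₀ _ (hp0 t)]
    simp only [this]
    rw [intervalIntegral.integral_sub intervalIntegrable_const hintC,
      intervalIntegral.integral_ofReal, hlog]
    simp

namespace SupportedCurve

variable {Ω : Set ℂ} (γ : SupportedCurve Ω)
variable {A : Type*} [NormedRing A] [NormedAlgebra ℂ A]

theorem continuous_pt : Continuous γ.pt := γ.locallyLipschitz.continuous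

theorem gap_le_norm (t : ℝ) : γ.gap ≤ ‖γ.pt t‖ := by
  refine (γ.gap_le t).trans ((Complex.re_le_norm _).trans ?_)
  rw [norm_mul, Complex.norm_conj, γ.norm_normal, one_mul]

theorem pt_ne_zero (t : ℝ) : γ.pt t ≠ 0 :=
  norm_pos_iff.1 (γ.gap_pos.trans_le (γ.gap_le_norm t))

/-- The resolvent `(γ(t) - s Z)⁻¹` along the curve. -/
def res (Z : A) (s t : ℝ) : A := Ring.inverse (algebraMap ℂ A (γ.pt t) - (s : ℂ) • Z)

/-- The resolvents `(γ(t) - s Z)⁻¹` exist for `0 ≤ s ≤ r` and are bounded by `M`. -/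
structure ResolventBound (Z : A) (r M : ℝ) : Prop where
  nonneg : 0 ≤ r
  isUnit : ∀ s ∈ Icc 0 r, ∀ t, IsUnit (algebraMap ℂ A (γ.pt t) - (s : ℂ) • Z)
  norm_le : ∀ s ∈ Icc 0 r, ∀ t, ‖γ.res Z s t‖ ≤ M

variable {γ} {Z : A} {r M : ℝ}

theorem ResolventBound.right_mem (h : γ.ResolventBound Z r M) : r ∈ Icc 0 r := ⟨h.nonneg, le_rfl⟩

section Resolvent

variable {s : ℝ}

theorem sub_mul_res (hu : ∀ t, IsUnit (algebraMap ℂ A (γ.pt t) - (s : ℂ) • Z))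
    (t : ℝ) :
    (algebraMap ℂ A (γ.pt t) - (s : ℂ) • Z) * γ.res Z s t = 1 :=
  Ring.mul_inverse_cancel _ (hu t)

theorem res_mul_sub (hu : ∀ t, IsUnit (algebraMap ℂ A (γ.pt t) - (s : ℂ) • Z))
    (t : ℝ) :
    γ.res Z s t * (algebraMap ℂ A (γ.pt t) - (s : ℂ) • Z) = 1 :=
  Ring.inverse_mul_cancel _ (hu t)

theorem commute_res (hu : ∀ t, IsUnit (algebraMap ℂ A (γ.pt t) - (s : ℂ) • Z))
    (t : ℝ) {a : A} (ha : Commute a Z) :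
    Commute a (γ.res Z s t) := by
  have h : Commute a (algebraMap ℂ A (γ.pt t) - (s : ℂ) • Z) :=
    Commute.sub_right (show Commute a _ from (Algebra.commutes (γ.pt t) a).symm)
      (Commute.smul_right ha _)
  obtain ⟨u, hu'⟩ := hu t
  rw [res, ← hu', Ring.inverse_unit]
  rw [← hu'] at h
  exact h.units_inv_right

theorem pt_smul_res (hu : ∀ t, IsUnit (algebraMap ℂ A (γ.pt t) - (s : ℂ) • Z))
    (t : ℝ) :
    γ.pt t • γ.res Z s t = 1 + (s : ℂ) • (Z * γ.res Z s t) := by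
  have := sub_mul_res hu t
  rw [sub_mul, Algebra.algebraMap_eq_smul_one, smul_mul_assoc, one_mul, smul_mul_assoc] at this
  rw [← this]; abel

variable [CompleteSpace A]

theorem locallyLipschitz_res (hu : ∀ t, IsUnit (algebraMap ℂ A (γ.pt t) - (s : ℂ) • Z)) :
    LocallyLipschitz (γ.res Z s) := by
  refine γ.locallyLipschitz.contDiffAt_comp
    (g := fun z : ℂ => Ring.inverse (algebraMap ℂ A z - (s : ℂ) • Z)) fun t => ?_
  obtain ⟨u, hu'⟩ := hu t
  have h1 : ContDiffAt ℂ 1 (fun z : ℂ => algebraMap ℂ A z - (s : ℂ) • Z) (γ.pt t) :=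
    ((Algebra.linearMap ℂ A).toContinuousLinearMap.contDiff.sub contDiff_const).contDiffAt
  have h2 : ContDiffAt ℂ 1 Ring.inverse (algebraMap ℂ A (γ.pt t) - (s : ℂ) • Z) := by
    rw [← hu']
    exact contDiffAt_ringInverse ℂ u
  exact (h2.comp (γ.pt t) h1).restrict_scalars ℝ

theorem continuous_res (hu : ∀ t, IsUnit (algebraMap ℂ A (γ.pt t) - (s : ℂ) • Z)) :
    Continuous (γ.res Z s) := (locallyLipschitz_res hu).continuous

theorem hasDerivAt_res (hu : ∀ t, IsUnit (algebraMap ℂ A (γ.pt t) - (s : ℂ) • Z))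
    {t : ℝ} (ht : HasDerivAt γ.pt (γ.vel t) t) :
    HasDerivAt (γ.res Z s) (-(γ.vel t • (γ.res Z s t * γ.res Z s t))) t := by
  obtain ⟨u, hu'⟩ := hu t
  have h1 : HasDerivAt (fun t => algebraMap ℂ A (γ.pt t) - (s : ℂ) • Z)
      (γ.vel t • (1 : A)) t := by
    simp only [Algebra.algebraMap_eq_smul_one]
    exact (ht.smul_const (1 : A)).sub_const _
  have h2 := (hasFDerivAt_ringInverse (𝕜 := ℝ) u)
  rw [hu'] at h2
  have h3 := h2.comp_hasDerivAt t h1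
  refine h3.congr_deriv ?_
  have hr : γ.res Z s t = ((u⁻¹ : Aˣ) : A) := by
    rw [res, ← hu', Ring.inverse_unit]
  simp [hr]

theorem integral_vel_smul_res_sq (hu : ∀ t, IsUnit (algebraMap ℂ A (γ.pt t) - (s : ℂ) • Z))
    (a : A) :
    ∫ t in (0 : ℝ)..2 * Real.pi, γ.vel t • (γ.res Z s t * γ.res Z s t * a) = 0 := by
  have hL := locallyLipschitz_res hu
  refine integral_eq_zero_of_periodic_of_locallyLipschitz (f := fun t => -(γ.res Z s t * a))
    Real.two_pi_pos ?_ ?_ ?_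
  · refine hL.contDiffAt_comp (g := fun b => -(b * a)) fun t => ?_
    exact (contDiffAt_id.mul contDiffAt_const).neg
  · intro t
    simp only [res, γ.periodic t]
  · filter_upwards [γ.hasDerivAt] with t ht
    have := ((hasDerivAt_res hu ht).mul_const a).neg
    refine this.congr_deriv ?_
    rw [neg_mul, neg_neg, smul_mul_assoc]

end Resolvent

theorem integral_pow_mul_vel (γ : SupportedCurve Ω) (k : ℕ) :
    ∫ t in (0 : ℝ)..2 * Real.pi, γ.pt t ^ k * γ.vel t = 0 := by
  have hk : ((k : ℂ) + 1) ≠ 0 := Nat.cast_add_one_ne_zero k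
  refine integral_eq_zero_of_periodic_of_locallyLipschitz
    (f := fun t => γ.pt t ^ (k + 1) / ((k : ℂ) + 1)) Real.two_pi_pos ?_ ?_ ?_
  · refine γ.locallyLipschitz.contDiffAt_comp (g := fun z => z ^ (k + 1) / ((k : ℂ) + 1))
      fun t => ?_
    simp only [div_eq_mul_inv]
    exact (contDiffAt_id.pow _).mul contDiffAt_const
  · intro t
    simp only [γ.periodic t]
  · filter_upwards [γ.hasDerivAt] with t ht
    have := (ht.pow (k + 1)).div_const ((k : ℂ) + 1)
    refine this.congr_deriv ?_
    push_cast
    field_simp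

theorem intervalIntegrable_vel_smul (γ : SupportedCurve Ω) {E : Type*} [NormedAddCommGroup E]
    [NormedSpace ℂ E] {f : ℝ → E} (hf : Continuous f) :
    IntervalIntegrable (fun t => γ.vel t • f t) volume 0 (2 * Real.pi) :=
  γ.intervalIntegrable.smul_continuousOn hf.continuousOn

variable [CompleteSpace A]

theorem norm_integral_vel_smul_le (γ : SupportedCurve Ω) {E : Type*} [NormedAddCommGroup E]
    [NormedSpace ℂ E] {f : ℝ → E} {C : ℝ} (hC : ∀ t, ‖f t‖ ≤ C) :
    ‖∫ t in (0 : ℝ)..2 * Real.pi, γ.vel t • f t‖ ≤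
      C * ∫ t in (0 : ℝ)..2 * Real.pi, ‖γ.vel t‖ := by
  rw [← intervalIntegral.integral_const_mul]
  refine intervalIntegral.norm_integral_le_of_norm_le Real.two_pi_pos.le
    (Eventually.of_forall fun t _ => ?_) (γ.intervalIntegrable.norm.const_mul C)
  rw [norm_smul, mul_comm]
  gcongr
  exact hC t

theorem ResolventBound.integral_vel_smul_res (h : γ.ResolventBound Z r M) {s : ℝ}
    (hs : s ∈ Icc 0 r) :
    ∫ t in (0 : ℝ)..2 * Real.pi, γ.vel t • γ.res Z s t = (2 * Real.pi * Complex.I) • (1 : A) := by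
  let L : ℝ → A := fun s => ∫ t in (0 : ℝ)..2 * Real.pi, γ.vel t • γ.res Z s t
  have hM : 0 ≤ M := (norm_nonneg _).trans (h.norm_le r h.right_mem 0)
  let C : ℝ := (M * ‖Z‖ * M * ‖Z‖ * M) * ∫ t in (0 : ℝ)..2 * Real.pi, ‖γ.vel t‖
  have hdiff : ∀ s ∈ Icc 0 r, ∀ s' ∈ Icc 0 r, ‖L s - L s'‖ ≤ C * |s - s'| ^ 2 := by
    intro s hs s' hs'
    have hu := h.isUnit s hs
    have hu' := h.isUnit s' hs'
    have hres : ∀ t, γ.res Z s t - γ.res Z s' t =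
        ((s - s' : ℝ) : ℂ) • (γ.res Z s t * Z * γ.res Z s' t) := by
      intro t
      have h1 := sub_mul_res hu' t
      have h2 := res_mul_sub hu t
      calc γ.res Z s t - γ.res Z s' t
          = γ.res Z s t * ((algebraMap ℂ A (γ.pt t) - (s' : ℂ) • Z) * γ.res Z s' t) -
            (γ.res Z s t * (algebraMap ℂ A (γ.pt t) - (s : ℂ) • Z)) * γ.res Z s' t := by
              rw [h1, h2, mul_one, one_mul]
        _ = _ := by
              push_cast
              simp only [mul_sub, sub_mul, sub_smul, smul_mul_assoc, mul_smul_comm, mul_assoc]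
              abel
    have hcom : ∀ t, Commute Z (γ.res Z s' t) := fun t => commute_res hu' t (Commute.refl Z)
    have hres2 : ∀ t, γ.vel t • γ.res Z s t - γ.vel t • γ.res Z s' t =
        ((s - s' : ℝ) : ℂ) • γ.vel t • (γ.res Z s' t * γ.res Z s' t * Z) +
        γ.vel t • ((((s - s' : ℝ) : ℂ) ^ 2) •
          (γ.res Z s t * Z * γ.res Z s' t * Z * γ.res Z s' t)) := by
      intro t
      have e1 : γ.res Z s t = γ.res Z s' t +
        ((s - s' : ℝ) : ℂ) • (γ.res Z s t * Z * γ.res Z s' t) := by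
        rw [← hres t]; abel
      rw [← smul_sub, hres t]
      conv_lhs => rw [e1]
      have hc : γ.res Z s' t * Z * γ.res Z s' t = γ.res Z s' t * γ.res Z s' t * Z := by
        rw [mul_assoc, (hcom t).eq, mul_assoc]
      simp only [add_mul, smul_mul_assoc, smul_add, hc, smul_smul, mul_assoc]
      congr 2 <;> ring
    have hc := continuous_res hu
    have hc' := continuous_res hu'
    have : L s - L s' = ∫ t in (0 : ℝ)..2 * Real.pi, γ.vel t • ((((s - s' : ℝ) : ℂ) ^ 2) •
          (γ.res Z s t * Z * γ.res Z s' t * Z * γ.res Z s' t)) := by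
      simp only [L]
      rw [← intervalIntegral.integral_sub (γ.intervalIntegrable_vel_smul hc)
        (γ.intervalIntegrable_vel_smul hc')]
      simp only [hres2]
      rw [intervalIntegral.integral_add, intervalIntegral.integral_smul,
        integral_vel_smul_res_sq hu', smul_zero, zero_add]
      · exact (γ.intervalIntegrable_vel_smul
          (f := fun t => γ.res Z s' t * γ.res Z s' t * Z) (by fun_prop)).smul ((s - s' : ℝ) : ℂ)
      · exact γ.intervalIntegrable_vel_smul (by fun_prop)
    rw [this]
    refine (γ.norm_integral_vel_smul_le (C := |s - s'| ^ 2 * (M * ‖Z‖ * M * ‖Z‖ * M))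
      fun t => ?_).trans_eq (by simp only [C]; ring)
    rw [norm_smul, norm_pow, Complex.norm_real, Real.norm_eq_abs]
    have n1 := h.norm_le s hs t
    have n2 := h.norm_le s' hs' t
    gcongr
    refine (norm_mul_le _ _).trans ?_
    gcongr
    refine (norm_mul_le _ _).trans ?_
    gcongr
    refine (norm_mul_le _ _).trans ?_
    gcongr
    refine (norm_mul_le _ _).trans ?_
    gcongr
  have hC : 0 ≤ C := by
    refine mul_nonneg (by positivity) ?_
    exact intervalIntegral.integral_nonneg Real.two_pi_pos.le fun t _ => norm_nonneg _
  have hderiv : ∀ s ∈ Icc 0 r, HasDerivWithinAt L 0 (Icc 0 r) s := by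
    intro s hs
    rw [hasDerivWithinAt_iff_isLittleO]
    have : (fun x' => L x' - L s - (x' - s) • (0 : A)) =O[𝓝[Icc 0 r] s] fun x' => (x' - s) ^ 2 := by
      refine Asymptotics.IsBigO.of_bound C ?_
      filter_upwards [self_mem_nhdsWithin] with x hx
      simpa using hdiff x hx s hs
    refine this.trans_isLittleO ?_
    have h2 : (fun x : ℝ => x ^ 2) =o[𝓝 0] fun x => x := by
      simpa using Asymptotics.isLittleO_pow_pow (𝕜 := ℝ) (m := 1) (n := 2) one_lt_two
    refine h2.comp_tendsto ((Continuous.tendsto' ?_ _ _ ?_).mono_left nhdsWithin_le_nhds)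
    · fun_prop
    · simp
  have hconst := constant_of_has_deriv_right_zero (f := L) (a := 0) (b := r)
    (fun s hs => (hderiv s hs).continuousWithinAt) (fun s hs =>
      (hderiv s ⟨hs.1, hs.2.le⟩).mono_of_mem_nhdsWithin (Icc_mem_nhdsGE_of_mem hs)) s hs
  rw [show (∫ t in (0 : ℝ)..2 * Real.pi, γ.vel t • γ.res Z s t) = L s from rfl, hconst]
  have hres0 : ∀ t, γ.vel t • γ.res Z 0 t = (γ.vel t / γ.pt t) • (1 : A) := fun t => by
    have : γ.res Z 0 t = (γ.pt t)⁻¹ • (1 : A) := by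
      have h1 := sub_mul_res (h.isUnit 0 ⟨le_rfl, h.nonneg⟩) t
      simp only [Complex.ofReal_zero, zero_smul, sub_zero] at h1
      rw [Algebra.algebraMap_eq_smul_one, smul_mul_assoc, one_mul] at h1
      rw [← h1, smul_smul, inv_mul_cancel₀ (γ.pt_ne_zero t), one_smul]
    rw [this, smul_smul, div_eq_mul_inv]
  simp only [L, hres0]
  rw [intervalIntegral.integral_smul_const, γ.winding]

theorem ResolventBound.integral_pow_smul_res (h : γ.ResolventBound Z r M) (k : ℕ) :
    ∫ t in (0 : ℝ)..2 * Real.pi, γ.vel t • (γ.pt t ^ k • γ.res Z r t) =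
      (2 * Real.pi * Complex.I) • ((r : ℂ) • Z) ^ k := by
  have hu := h.isUnit r h.right_mem
  have hc := continuous_res hu
  have hp := γ.continuous_pt
  induction k with
  | zero => simpa using h.integral_vel_smul_res h.right_mem
  | succ k ih =>
    have step : ∀ t, γ.vel t • (γ.pt t ^ (k + 1) • γ.res Z r t) =
        (γ.pt t ^ k * γ.vel t) • (1 : A) +
          ((r : ℂ) • Z) * γ.vel t • (γ.pt t ^ k • γ.res Z r t) := fun t => by
      rw [pow_succ, mul_smul, pt_smul_res hu t]
      simp only [smul_add, smul_smul, mul_smul_comm, smul_mul_assoc]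
      congr 2 <;> ring
    simp only [step]
    rw [intervalIntegral.integral_add, intervalIntegral.integral_smul_const,
      γ.integral_pow_mul_vel, zero_smul, zero_add, pow_succ']
    · have := ((ContinuousLinearMap.mul ℂ A) ((r : ℂ) • Z)).intervalIntegral_comp_comm
        (γ.intervalIntegrable_vel_smul (f := fun t => γ.pt t ^ k • γ.res Z r t) (by fun_prop))
      simp only [ContinuousLinearMap.mul_apply'] at this
      rw [this, ih, mul_smul_comm]
    · have := γ.intervalIntegrable_vel_smul (f := fun t => γ.pt t ^ k • (1 : A)) (by fun_prop)
      simpa only [smul_smul, mul_comm] using this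
    · have := γ.intervalIntegrable_vel_smul
        (f := fun t => ((r : ℂ) • Z) * (γ.pt t ^ k • γ.res Z r t)) (by fun_prop)
      simpa only [mul_smul_comm] using this

/-- Cauchy's integral formula for polynomials with coefficients commuting with `Z`. -/
theorem ResolventBound.integral_eval (h : γ.ResolventBound Z r M) {B : Type*} [NormedRing B]
    [NormedAlgebra ℂ B] (J : B →ₐ[ℂ] A) (F : B[X]) :
    ∫ t in (0 : ℝ)..2 * Real.pi,
        γ.vel t • (J (F.eval (algebraMap ℂ B (γ.pt t))) * γ.res Z r t) =
      (2 * Real.pi * Complex.I) • F.eval₂ (J : B →+* A) ((r : ℂ) • Z) := by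
  have hu := h.isUnit r h.right_mem
  have hc := continuous_res hu
  have hp := γ.continuous_pt
  have hev : ∀ (F : B[X]) (z : ℂ), J (F.eval (algebraMap ℂ B z)) =
      F.sum fun k b => z ^ k • J b := by
    intro F z
    rw [Polynomial.eval_eq_sum, Polynomial.sum, map_sum, Polynomial.sum]
    refine Finset.sum_congr rfl fun k _ => ?_
    rw [map_mul, map_pow, AlgHom.commutes, ← map_pow, ← Algebra.commutes, Algebra.smul_def]
  simp only [hev, Polynomial.sum, Finset.sum_mul, Finset.smul_sum]
  rw [intervalIntegral.integral_finsetSum, Polynomial.eval₂_eq_sum, Polynomial.sum,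
    Finset.smul_sum]
  · refine Finset.sum_congr rfl fun k _ => ?_
    have := ((ContinuousLinearMap.mul ℂ A) (J (F.coeff k))).intervalIntegral_comp_comm
        (γ.intervalIntegrable_vel_smul (f := fun t => γ.pt t ^ k • γ.res Z r t) (by fun_prop))
    simp only [ContinuousLinearMap.mul_apply', h.integral_pow_smul_res, mul_smul_comm] at this
    simpa only [smul_mul_assoc, AlgHom.coe_toRingHom, RingHom.coe_coe] using this
  · intro k _
    exact γ.intervalIntegrable_vel_smul (by fun_prop)

end SupportedCurve

section Positive

variable {H : Type*} [NormedAddCommGroup H] [InnerProductSpace ℂ H] [CompleteSpace H]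

theorem norm_inner_mul_apply_le_of_nonneg {F P : H →L[ℂ] H} (hP : 0 ≤ P) (hFP : Commute F P)
    (x y : H) :
    ‖⟪y, (F * P) x⟫_ℂ‖ ≤ ‖F‖ * (((⟪y, P y⟫_ℂ).re + (⟪x, P x⟫_ℂ).re) / 2) := by
  set Q := CFC.sqrt P with hQ
  have hQ0 : 0 ≤ Q := CFC.sqrt_nonneg P
  have hQQ : Q * Q = P := CFC.sqrt_mul_sqrt_self P hP
  have hQF : Commute Q F := Commute.cfcₙ_nnreal hFP.symm _
  have hsymm : ∀ u v : H, ⟪Q u, v⟫_ℂ = ⟪u, Q v⟫_ℂ :=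
    ((nonneg_iff_isPositive Q).1 hQ0).inner_left_eq_inner_right
  have hsq : ∀ u : H, ‖Q u‖ ^ 2 = (⟪u, P u⟫_ℂ).re := fun u => by
    rw [← hQQ, show (Q * Q) u = Q (Q u) from rfl, ← hsymm, inner_self_eq_norm_sq_to_K]
    norm_cast
  have h1 : ⟪y, (F * P) x⟫_ℂ = ⟪Q y, F (Q x)⟫_ℂ := by
    rw [hsymm, ← hQQ, ← mul_assoc, ← hQF.eq, mul_assoc]
    rfl
  rw [h1, ← hsq, ← hsq]
  have h2 : ‖⟪Q y, F (Q x)⟫_ℂ‖ ≤ ‖Q y‖ * (‖F‖ * ‖Q x‖) :=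
    (norm_inner_le_norm _ _).trans (by gcongr; exact F.le_opNorm _)
  have h3 := mul_nonneg (norm_nonneg F) (sq_nonneg (‖Q y‖ - ‖Q x‖))
  nlinarith

theorem norm_integral_mul_le_of_nonneg {F P : ℝ → H →L[ℂ] H} {a b m k : ℝ} (hab : a ≤ b)
    (hPi : IntervalIntegrable P volume a b)
    (hFPi : IntervalIntegrable (fun t => F t * P t) volume a b) (hP : ∀ᵐ t, 0 ≤ P t)
    (hFP : ∀ t, Commute (F t) (P t)) (hm : ∀ t, ‖F t‖ ≤ m) (hk : 0 ≤ k)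
    (hint : ∫ t in a..b, P t = (k : ℂ) • (1 : H →L[ℂ] H)) :
    ‖∫ t in a..b, F t * P t‖ ≤ k * m := by
  have hm0 : 0 ≤ m := (norm_nonneg _).trans (hm 0)
  have happ : ∀ (S : ℝ → H →L[ℂ] H), IntervalIntegrable S volume a b → ∀ x y : H,
      IntervalIntegrable (fun t => ⟪y, S t x⟫_ℂ) volume a b ∧
      ∫ t in a..b, ⟪y, S t x⟫_ℂ = ⟪y, (∫ t in a..b, S t) x⟫_ℂ := by
    intro S hS x y
    let L : (H →L[ℂ] H) →L[ℂ] ℂ := (innerSL ℂ y) ∘L (ContinuousLinearMap.apply ℂ H x)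
    refine ⟨⟨L.integrable_comp hS.1, L.integrable_comp hS.2⟩, ?_⟩
    exact L.intervalIntegral_comp_comm hS
  have hre : ∀ x : H, IntervalIntegrable (fun t => (⟪x, P t x⟫_ℂ).re) volume a b ∧
      ∫ t in a..b, (⟪x, P t x⟫_ℂ).re = k * ‖x‖ ^ 2 := by
    intro x
    obtain ⟨h1, h2⟩ := happ P hPi x x
    refine ⟨⟨Complex.reCLM.integrable_comp h1.1, Complex.reCLM.integrable_comp h1.2⟩, ?_⟩
    have := Complex.reCLM.intervalIntegral_comp_comm h1
    simp only [Complex.reCLM_apply] at this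
    rw [this, h2, hint, smul_apply, one_apply_eq_self, inner_smul_right,
      Complex.re_ofReal_mul]
    congr 1
    exact inner_self_eq_norm_sq (𝕜 := ℂ) x
  refine opNorm_le_of_re_inner_le (𝕜 := ℂ) (mul_nonneg hk hm0) fun x y hx hy => ?_
  obtain ⟨h1, h2⟩ := happ _ hFPi x y
  have key : ‖⟪y, (∫ t in a..b, F t * P t) x⟫_ℂ‖ ≤
      ∫ t in a..b, m * (((⟪y, P t y⟫_ℂ).re + (⟪x, P t x⟫_ℂ).re) / 2) := by
    rw [← h2]
    refine intervalIntegral.norm_integral_le_of_norm_le hab ?_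
      ((((hre y).1.add (hre x).1).div_const 2).const_mul m)
    filter_upwards [hP] with t ht _
    refine (norm_inner_mul_apply_le_of_nonneg ht (hFP t) x y).trans ?_
    have hnn : ∀ u, 0 ≤ (⟪u, P t u⟫_ℂ).re :=
      fun u => ((nonneg_iff_isPositive _).1 ht).re_inner_nonneg_right u
    have := hnn x
    have := hnn y
    gcongr
    exact hm t
  rw [intervalIntegral.integral_const_mul, intervalIntegral.integral_div,
    intervalIntegral.integral_add (hre y).1 (hre x).1, (hre x).2, (hre y).2, hx, hy] at key
  rw [← inner_conj_symm, RCLike.conj_re]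
  refine (RCLike.re_le_norm _).trans (key.trans_eq ?_)
  ring

end Positive

section HalfPlane

variable {H : Type*} [NormedAddCommGroup H] [InnerProductSpace ℂ H]

/-- Every half-plane that contains `Ω` contains the numerical range of `T`. -/
def HalfPlaneRange (T : H →L[ℂ] H) (Ω : Set ℂ) : Prop :=
  ∀ (ν : ℂ) (c : ℝ), (∀ z ∈ Ω, (conj ν * z).re ≤ c) →
    ∀ x, (conj ν * ⟪x, T x⟫_ℂ).re ≤ c * ‖x‖ ^ 2

theorem halfPlaneRange_algebraMap {Ω : Set ℂ} {z : ℂ} (hz : z ∈ Ω) :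
    HalfPlaneRange (algebraMap ℂ (H →L[ℂ] H) z) Ω := by
  intro ν c h x
  rw [Algebra.algebraMap_eq_smul_one, smul_apply, one_apply_eq_self, inner_smul_right,
    inner_self_eq_norm_sq_to_K, ← mul_assoc]
  have : (conj ν * z * ((‖x‖ : ℝ) : ℂ) ^ 2).re = (conj ν * z).re * ‖x‖ ^ 2 := by
    rw [← Complex.ofReal_pow, Complex.re_mul_ofReal]
  refine this.trans_le ?_
  have := h z hz
  gcongr

variable {Ω : Set ℂ} (γ : SupportedCurve Ω) {T : H →L[ℂ] H}

namespace SupportedCurve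

theorem le_re_inner_sub (hT : HalfPlaneRange T Ω) {s : ℝ} (hs0 : 0 ≤ s) (hs1 : s ≤ 1) (t : ℝ)
    (x : H) :
    (1 - s) * γ.gap * ‖x‖ ^ 2 ≤
      (conj (γ.normal t) * ⟪x, (algebraMap ℂ (H →L[ℂ] H) (γ.pt t) - (s : ℂ) • T) x⟫_ℂ).re := by
  have h1 := hT _ _ (γ.support t) x
  have h2 := γ.gap_le t
  rw [sub_apply, Algebra.algebraMap_eq_smul_one, smul_apply, smul_apply, one_apply_eq_self,
    inner_sub_right, inner_smul_right, inner_smul_right, inner_self_eq_norm_sq_to_K]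
  have : (conj (γ.normal t) * (γ.pt t * ((‖x‖ : ℝ) : ℂ) ^ 2 - s * ⟪x, T x⟫_ℂ)).re =
      (conj (γ.normal t) * γ.pt t).re * ‖x‖ ^ 2 - s * (conj (γ.normal t) * ⟪x, T x⟫_ℂ).re := by
    rw [mul_sub, Complex.sub_re, ← mul_assoc, ← Complex.ofReal_pow, Complex.re_mul_ofReal,
      mul_left_comm, Complex.re_ofReal_mul]
  refine le_trans ?_ this.ge
  have h3 := mul_le_mul_of_nonneg_left h1 hs0
  have h4 := mul_le_mul_of_nonneg_left h2 (mul_nonneg (sub_nonneg.2 hs1) (sq_nonneg ‖x‖))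
  nlinarith

variable [CompleteSpace H]

theorem resolventBound (hT : HalfPlaneRange T Ω) {r : ℝ} (hr0 : 0 ≤ r) (hr1 : r < 1) :
    γ.ResolventBound T r (((1 - r) * γ.gap)⁻¹) := by
  have hc : 0 < (1 - r) * γ.gap := mul_pos (sub_pos.2 hr1) γ.gap_pos
  have key : ∀ s ∈ Icc 0 r, ∀ t, ∀ x, ‖x‖ ^ 2 * ((1 - r) * γ.gap) ≤
      ‖⟪(algebraMap ℂ (H →L[ℂ] H) (γ.pt t) - (s : ℂ) • T) x, x⟫_ℂ‖ := by
    intro s hs t x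
    have h1 := γ.le_re_inner_sub hT hs.1 (hs.2.trans hr1.le) t x
    have h2 : (1 - r) * γ.gap ≤ (1 - s) * γ.gap := by
      have := γ.gap_pos
      gcongr
      exact hs.2
    rw [mul_comm, norm_inner_symm]
    refine (mul_le_mul_of_nonneg_right h2 (sq_nonneg _)).trans (h1.trans ?_)
    refine (Complex.re_le_norm _).trans ?_
    rw [norm_mul, Complex.norm_conj, γ.norm_normal, one_mul]
  have hunit : ∀ s ∈ Icc 0 r, ∀ t, IsUnit (algebraMap ℂ (H →L[ℂ] H) (γ.pt t) - (s : ℂ) • T) :=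
    fun s hs t => isUnit_of_forall_le_norm_inner_map _ (c := ⟨_, hc.le⟩) hc (key s hs t)
  refine ⟨hr0, hunit, fun s hs t => opNorm_le_bound _ (inv_nonneg.2 hc.le) fun x => ?_⟩
  have h1 := key s hs t (γ.res T s t x)
  have h2 := congrArg (fun S : H →L[ℂ] H => S x)
    (Ring.mul_inverse_cancel _ (hunit s hs t))
  simp only [one_apply_eq_self] at h2
  rw [show (algebraMap ℂ (H →L[ℂ] H) (γ.pt t) - (s : ℂ) • T) (γ.res T s t x) = x from h2] at h1
  have h3 := h1.trans (norm_inner_le_norm _ _)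
  rw [inv_mul_eq_div, le_div_iff₀ hc]
  rcases (norm_nonneg (γ.res T s t x)).eq_or_lt with h0 | h0
  · rw [← h0]; simp
  · nlinarith

/-- The Cauchy transform along the curve of `t ↦ F(γ(t))^*`, evaluated at `r Z`. -/
def conjTransform {A B : Type*} [NormedRing A] [NormedAlgebra ℂ A] [NormedRing B]
    [NormedAlgebra ℂ B] [Star B] (J : B →ₐ[ℂ] A) (F : B[X]) (Z : A) (r : ℝ) : A :=
  (2 * Real.pi * Complex.I : ℂ)⁻¹ • ∫ t in (0 : ℝ)..2 * Real.pi,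
    γ.vel t • (J (star (F.eval (algebraMap ℂ B (γ.pt t)))) * γ.res Z r t)

theorem norm_eval₂_add_star_conjTransform_le (hT : HalfPlaneRange T Ω) {r : ℝ} (hr0 : 0 ≤ r)
    (hr1 : r < 1) {B : Type*} [CStarAlgebra B] (J : B →⋆ₐ[ℂ] (H →L[ℂ] H))
    (hJ : ∀ b, Commute (J b) T) (F : B[X]) {m : ℝ}
    (hm : ∀ z ∈ Ω, ‖F.eval (algebraMap ℂ B z)‖ ≤ m) :
    ‖F.eval₂ (J : B →+* (H →L[ℂ] H)) ((r : ℂ) • T) +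
      star (γ.conjTransform (J : B →ₐ[ℂ] (H →L[ℂ] H)) F T r)‖ ≤ 2 * m := by
  have hR := γ.resolventBound hT hr0 hr1
  have hu := hR.isUnit r hR.right_mem
  have hc := continuous_res hu
  have hp := γ.continuous_pt
  have hJc : Continuous J := by
    refine AddMonoidHomClass.continuous_of_bound J 1 fun b => ?_
    rw [one_mul]
    exact NonUnitalStarAlgHom.norm_apply_le J b
  set w : ℂ := 2 * Real.pi * Complex.I with hw
  have hw0 : w ≠ 0 := Complex.two_pi_I_ne_zero
  let f : ℝ → H →L[ℂ] H := fun t => J (F.eval (algebraMap ℂ B (γ.pt t)))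
  have hevc : Continuous fun t => F.eval (algebraMap ℂ B (γ.pt t)) :=
    F.continuous.comp ((algebraMapCLM ℂ B).continuous.comp hp)
  have hfc : Continuous f := hJc.comp hevc
  let W : ℝ → H →L[ℂ] H := fun t => w⁻¹ • γ.vel t • γ.res T r t
  have hWi : IntervalIntegrable W volume 0 (2 * Real.pi) :=
    (γ.intervalIntegrable_vel_smul hc).smul w⁻¹
  have hWint : ∫ t in (0 : ℝ)..2 * Real.pi, W t = 1 := by
    simp only [W]
    rw [intervalIntegral.integral_smul, hR.integral_vel_smul_res hR.right_mem, smul_smul,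
      inv_mul_cancel₀ hw0, one_smul]
  have hstari : ∀ {S : ℝ → H →L[ℂ] H}, IntervalIntegrable S volume 0 (2 * Real.pi) →
      IntervalIntegrable (fun t => star (S t)) volume 0 (2 * Real.pi) := fun {S} hS =>
    ⟨(starL' ℝ : (H →L[ℂ] H) ≃L[ℝ] (H →L[ℂ] H)).toContinuousLinearMap.integrable_comp hS.1,
      (starL' ℝ : (H →L[ℂ] H) ≃L[ℝ] (H →L[ℂ] H)).toContinuousLinearMap.integrable_comp hS.2⟩
  have hstarint : ∀ {S : ℝ → H →L[ℂ] H}, IntervalIntegrable S volume 0 (2 * Real.pi) →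
      ∫ t in (0 : ℝ)..2 * Real.pi, star (S t) = star (∫ t in (0 : ℝ)..2 * Real.pi, S t) :=
    fun {S} hS => (starL' ℝ : (H →L[ℂ] H) ≃L[ℝ] (H →L[ℂ] H)).toContinuousLinearMap
      |>.intervalIntegral_comp_comm hS
  have hfR : ∀ b t, Commute (J b) (γ.res T r t) := fun b t => commute_res hu t (hJ b)
  have hfW : ∀ b t, Commute (J b) (W t) := fun b t => ((hfR b t).smul_right _).smul_right _
  have hfWs : ∀ b t, Commute (J b) (star (W t)) := fun b t => by
    have := (hfW (star b) t).star_star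
    rwa [map_star, star_star] at this
  have hfWi : IntervalIntegrable (fun t => f t * W t) volume 0 (2 * Real.pi) := by
    have := (γ.intervalIntegrable_vel_smul (hfc.mul hc)).smul w⁻¹
    refine this.congr fun t _ => ?_
    simp only [W, mul_smul_comm, Pi.smul_apply, Pi.mul_apply]
  have hfsWi : IntervalIntegrable (fun t => star (f t) * W t) volume 0 (2 * Real.pi) := by
    have := (γ.intervalIntegrable_vel_smul (hfc.star.mul hc)).smul w⁻¹
    refine this.congr fun t _ => ?_
    simp only [W, mul_smul_comm, Pi.smul_apply, Pi.mul_apply]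
  have hfWsi : IntervalIntegrable (fun t => f t * star (W t)) volume 0 (2 * Real.pi) := by
    refine (hstari hfsWi).congr fun t _ => ?_
    simp only [star_mul, star_star]
    exact (hfWs _ t).eq.symm
  have h1 : F.eval₂ (J : B →+* (H →L[ℂ] H)) ((r : ℂ) • T) =
      ∫ t in (0 : ℝ)..2 * Real.pi, f t * W t := by
    have := hR.integral_eval (J : B →ₐ[ℂ] (H →L[ℂ] H)) F
    simp only [f, W, mul_smul_comm]
    rw [intervalIntegral.integral_smul]
    refine (eq_inv_smul_iff₀ hw0).2 ?_
    exact this.symm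
  have h2 : star (γ.conjTransform (J : B →ₐ[ℂ] (H →L[ℂ] H)) F T r) =
      ∫ t in (0 : ℝ)..2 * Real.pi, f t * star (W t) := by
    have : γ.conjTransform (J : B →ₐ[ℂ] (H →L[ℂ] H)) F T r =
        ∫ t in (0 : ℝ)..2 * Real.pi, star (f t) * W t := by
      simp only [conjTransform, f, W, mul_smul_comm, ← map_star]
      rw [intervalIntegral.integral_smul]
      rfl
    rw [this, ← hstarint hfsWi]
    refine intervalIntegral.integral_congr fun t _ => ?_
    simp only [star_mul, star_star]
    exact (hfWs _ t).eq.symm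
  rw [h1, h2, ← intervalIntegral.integral_add hfWi hfWsi]
  simp only [← mul_add]
  refine norm_integral_mul_le_of_nonneg Real.two_pi_pos.le (hWi.add (hstari hWi)) ?_ ?_
    (fun t => (hfW _ t).add_right (hfWs _ t)) (fun t => ?_) zero_le_two ?_
  · refine (hfWi.add hfWsi).congr fun t _ => ?_
    simp [mul_add]
  · filter_upwards [γ.tangent] with t ht
    obtain ⟨c, hc0, hvel⟩ := ht
    rw [nonneg_iff_isPositive, isPositive_def]
    refine ⟨((IsSelfAdjoint.add_star_self (W t)).isSymmetric), fun x => ?_⟩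
    have hin : 0 ≤ (⟪x, W t x⟫_ℂ).re := by
      set u := γ.res T r t x
      have hx : (algebraMap ℂ (H →L[ℂ] H) (γ.pt t) - (r : ℂ) • T) u = x :=
        congrArg (fun S : H →L[ℂ] H => S x) (sub_mul_res hu t)
      have hk : w⁻¹ * γ.vel t = (c / (2 * Real.pi) : ℝ) * γ.normal t := by
        rw [hvel, hw]
        have := Real.pi_ne_zero
        push_cast
        field_simp
      have hWx : W t x = (w⁻¹ * γ.vel t) • u := by
        simp only [W, smul_smul, smul_apply, u]
      have h3 := γ.le_re_inner_sub hT hr0 hr1.le t u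
      rw [hx] at h3
      have h4 : 0 ≤ (conj (γ.normal t) * ⟪u, x⟫_ℂ).re :=
        le_trans (mul_nonneg (mul_nonneg (sub_nonneg.2 hr1.le) γ.gap_pos.le) (sq_nonneg _)) h3
      rw [hWx, hk, inner_smul_right, mul_assoc, Complex.re_ofReal_mul]
      refine mul_nonneg (div_nonneg hc0 Real.two_pi_pos.le) ?_
      rwa [← Complex.conj_re, map_mul, inner_conj_symm]
    rw [reApplyInnerSelf_apply, add_apply, inner_add_left, star_eq_adjoint, adjoint_inner_left,
      map_add, inner_re_symm]
    exact add_nonneg hin hin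
  · exact (NonUnitalStarAlgHom.norm_apply_le J _).trans (hm _ (γ.mem t))
  · rw [intervalIntegral.integral_add hWi (hstari hWi), hstarint hWi, hWint, star_one,
      ← one_add_one_eq_two]
    push_cast
    rw [add_smul, one_smul]

end SupportedCurve

end HalfPlane

namespace SupportedCurve

section Algebra

variable {Ω : Set ℂ} {γ : SupportedCurve Ω} {A : Type*} [NormedRing A] [NormedAlgebra ℂ A]
  {Z : A} {r : ℝ}

theorem map_res {A' : Type*} [NormedRing A'] [NormedAlgebra ℂ A'] (φ : A →ₐ[ℂ] A')
    (hu : ∀ t, IsUnit (algebraMap ℂ A (γ.pt t) - (r : ℂ) • Z)) (t : ℝ) :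
    φ (γ.res Z r t) = γ.res (φ Z) r t := by
  obtain ⟨u, hu'⟩ := hu t
  have h1 : algebraMap ℂ A' (γ.pt t) - (r : ℂ) • φ Z = (Units.map (φ : A →* A') u : A'ˣ) := by
    rw [Units.coe_map, hu']
    simp only [MonoidHom.coe_coe, map_sub, map_smul, AlgHom.commutes]
  rw [res, res, h1, ← hu', Ring.inverse_unit, Ring.inverse_unit, ← map_inv]
  rfl

variable [CompleteSpace A]

theorem res_mem (S : Subalgebra ℂ A) (hS : IsClosed (S : Set A)) (hZ : Z ∈ S) (hr : 0 ≤ r)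
    (hu : ∀ s ∈ Icc 0 r, ∀ t, IsUnit (algebraMap ℂ A (γ.pt t) - (s : ℂ) • Z)) (t : ℝ) :
    γ.res Z r t ∈ S := by
  have : IsClosed (S : Set A) := hS
  let x : S := ⟨(r : ℂ) • Z, S.smul_mem hZ _⟩
  have hx : γ.pt t ∉ spectrum ℂ x := by
    intro hmem
    have hb := Subalgebra.spectrum_isBounded_connectedComponentIn S x hmem
    let f : ℝ → ℂ := fun a => (a : ℂ) * γ.pt t
    have hf : Continuous f := by fun_prop
    have hsub : f '' Ici 1 ⊆ connectedComponentIn (spectrum ℂ (x : A))ᶜ (γ.pt t) := by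
      refine (isPreconnected_Ici.image f hf.continuousOn).subset_connectedComponentIn
        ⟨1, mem_Ici.2 le_rfl, by simp [f]⟩ ?_
      rintro _ ⟨a, ha, rfl⟩
      have ha0 : (0 : ℝ) < a := zero_lt_one.trans_le ha
      have ha0' : (a : ℂ) ≠ 0 := Complex.ofReal_ne_zero.2 ha0.ne'
      rw [mem_compl_iff, spectrum.mem_iff, not_not]
      have h1 : algebraMap ℂ A (f a) - (x : A) =
          (Units.mk0 (a : ℂ) ha0') • (algebraMap ℂ A (γ.pt t) - ((r / a : ℝ) : ℂ) • Z) := by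
        have h2 : (a : ℂ) * ((r / a : ℝ) : ℂ) = r := by
          push_cast
          field_simp
        rw [Units.smul_mk0, smul_sub, smul_smul, h2, Algebra.algebraMap_eq_smul_one,
          Algebra.algebraMap_eq_smul_one, smul_smul]
      rw [h1]
      exact (hu (r / a) ⟨by positivity, div_le_self hr ha⟩ t).smul _
    obtain ⟨R, hR⟩ := (hb.subset hsub).exists_norm_le
    have hp := norm_pos_iff.2 (γ.pt_ne_zero t)
    have h2 := hR (f (max 1 (R / ‖γ.pt t‖ + 1))) ⟨_, mem_Ici.2 (le_max_left _ _), rfl⟩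
    simp only [f, norm_mul, Complex.norm_real, Real.norm_eq_abs] at h2
    have h3 : R / ‖γ.pt t‖ + 1 ≤ |max 1 (R / ‖γ.pt t‖ + 1)| :=
      (le_max_right _ _).trans (le_abs_self _)
    have h4 := (mul_le_mul_of_nonneg_right h3 hp.le).trans h2
    rw [add_mul, div_mul_cancel₀ _ hp.ne'] at h4
    linarith
  rw [spectrum.mem_iff, not_not] at hx
  obtain ⟨u, hu'⟩ := hx
  have h1 : algebraMap ℂ A (γ.pt t) - (r : ℂ) • Z = (Units.map (S.val : S →* A) u : Aˣ) := by
    rw [Units.coe_map, hu']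
    rfl
  rw [res, h1, Ring.inverse_unit, ← map_inv]
  exact (((u⁻¹ : Sˣ) : S)).2

variable {B : Type*} [NormedRing B] [NormedAlgebra ℂ B] [StarRing B] [ContinuousStar B]
  {J : B →ₐ[ℂ] A}

theorem continuous_conj_mul_res (hJ : Continuous J) (F : B[X])
    (hu : ∀ t, IsUnit (algebraMap ℂ A (γ.pt t) - (r : ℂ) • Z)) :
    Continuous fun t => J (star (F.eval (algebraMap ℂ B (γ.pt t)))) * γ.res Z r t :=
  (hJ.comp (F.continuous.comp ((algebraMapCLM ℂ B).continuous.comp γ.continuous_pt)).star).mul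
    (continuous_res hu)

theorem map_conjTransform {A' : Type*} [NormedRing A'] [NormedAlgebra ℂ A'] [CompleteSpace A']
    (φ : A →ₐ[ℂ] A') (hφ : Continuous φ) (hJ : Continuous J) (F : B[X])
    (hu : ∀ t, IsUnit (algebraMap ℂ A (γ.pt t) - (r : ℂ) • Z)) :
    φ (γ.conjTransform J F Z r) = γ.conjTransform (φ.comp J) F (φ Z) r := by
  let L : A →L[ℂ] A' := ⟨φ.toLinearMap, hφ⟩
  have h1 := L.intervalIntegral_comp_comm
    (γ.intervalIntegrable_vel_smul (continuous_conj_mul_res hJ F hu))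
  have h2 : ∀ a, L a = φ a := fun _ => rfl
  simp only [h2, map_smul, map_mul, map_res φ hu] at h1
  rw [conjTransform, conjTransform, map_smul, ← h1]
  rfl

theorem conjTransform_mem (S : Subalgebra ℂ A) (hS : IsClosed (S : Set A)) (hZ : Z ∈ S)
    (hJS : ∀ b, J b ∈ S) (hJ : Continuous J) (F : B[X]) (hr : 0 ≤ r)
    (hu : ∀ s ∈ Icc 0 r, ∀ t, IsUnit (algebraMap ℂ A (γ.pt t) - (s : ℂ) • Z)) :
    γ.conjTransform J F Z r ∈ S := by
  have hmem : ∀ t, J (star (F.eval (algebraMap ℂ B (γ.pt t)))) * γ.res Z r t ∈ S :=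
    fun t => S.mul_mem (hJS _) (res_mem S hS hZ hr hu t)
  have hcont := continuous_conj_mul_res hJ F (hu r ⟨hr, le_rfl⟩)
  let g : ℝ → Subalgebra.toSubmodule S := fun t => ⟨_, hmem t⟩
  have hg : Continuous g := hcont.subtype_mk _
  have : CompleteSpace (Subalgebra.toSubmodule S) := hS.completeSpace_coe
  have h1 := (Subalgebra.toSubmodule S).subtypeL.intervalIntegral_comp_comm
    (γ.intervalIntegrable_vel_smul hg)
  have h2 : γ.conjTransform J F Z r = (2 * Real.pi * Complex.I : ℂ)⁻¹ •
      ((∫ t in (0 : ℝ)..2 * Real.pi, γ.vel t • g t : Subalgebra.toSubmodule S) : A) := by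
    rw [conjTransform]
    congr 1
  rw [h2]
  exact S.smul_mem (Subtype.prop _) _

end Algebra

end SupportedCurve

section Spectral

variable {E H : Type*} [NormedAddCommGroup E] [InnerProductSpace ℂ E] [CompleteSpace E]
  [NormedAddCommGroup H] [InnerProductSpace ℂ H] [CompleteSpace H]

/-- `Ω` is `K`-spectral for `T`, for polynomials with operator coefficients. -/
def IsOperatorSpectral (J : (E →L[ℂ] E) →⋆ₐ[ℂ] (H →L[ℂ] H)) (T : H →L[ℂ] H) (Ω : Set ℂ)
    (K : ℝ) : Prop :=
  ∀ (F : (E →L[ℂ] E)[X]) (m : ℝ), (∀ z ∈ Ω, ‖F.eval (algebraMap ℂ (E →L[ℂ] E) z)‖ ≤ m) →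
    ‖F.eval₂ (J : (E →L[ℂ] E) →+* (H →L[ℂ] H)) T‖ ≤ K * m

/-- Evaluation at a point, as an algebra homomorphism. -/
def evalAtAlgHom (X B : Type*) [TopologicalSpace X] [NormedRing B] [NormedAlgebra ℂ B] (x : X) :
    C(X, B) →ₐ[ℂ] B where
  toFun f := f x
  map_one' := rfl
  map_mul' _ _ := rfl
  map_zero' := rfl
  map_add' _ _ := rfl
  commutes' _ := rfl

/-- Constant functions, as an algebra homomorphism. -/
def constMapAlgHom (X B : Type*) [TopologicalSpace X] [NormedRing B] [NormedAlgebra ℂ B] :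
    B →ₐ[ℂ] C(X, B) where
  toFun b := ContinuousMap.const X b
  map_one' := rfl
  map_mul' _ _ := rfl
  map_zero' := rfl
  map_add' _ _ := rfl
  commutes' _ := rfl

theorem continuous_starAlgHom {A B : Type*} [CStarAlgebra A] [CStarAlgebra B] (J : A →⋆ₐ[ℂ] B) :
    Continuous J := by
  refine AddMonoidHomClass.continuous_of_bound J 1 fun b => ?_
  rw [one_mul]
  exact NonUnitalStarAlgHom.norm_apply_le J b

variable {J : (E →L[ℂ] E) →⋆ₐ[ℂ] (H →L[ℂ] H)} {T : H →L[ℂ] H} {Ω : Set ℂ} {K : ℝ}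

theorem norm_eval₂_mul_conjTransform_mul_eval₂_le {B A : Type*} [CStarAlgebra B] [CStarAlgebra A]
    {J : B →ₐ[ℂ] A} (hJc : Continuous J) {T : A} (hJ : ∀ b, Commute (J b) T)
    (hcomp : IsCompact Ω) (γ : SupportedCurve Ω)
    (hK : ∀ (F : B[X]) (m : ℝ), (∀ z ∈ Ω, ‖F.eval (algebraMap ℂ B z)‖ ≤ m) →
      ‖F.eval₂ (J : B →+* A) T‖ ≤ K * m) (hK0 : 0 ≤ K) (F : B[X]) {m k : ℝ}
    (hm : ∀ z ∈ Ω, ‖F.eval (algebraMap ℂ B z)‖ ≤ m) {r : ℝ} (hr0 : 0 ≤ r)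
    (huB : ∀ z ∈ Ω, ∀ s ∈ Icc 0 r, ∀ t,
      IsUnit (algebraMap ℂ B (γ.pt t) - (s : ℂ) • algebraMap ℂ B z))
    (huA : ∀ s ∈ Icc 0 r, ∀ t, IsUnit (algebraMap ℂ A (γ.pt t) - (s : ℂ) • T))
    (hk : ∀ z ∈ Ω, ‖γ.conjTransform (AlgHom.id ℂ B) F (algebraMap ℂ B z) r‖ ≤ k) :
    ‖F.eval₂ (J : B →+* A) T * γ.conjTransform J F T r * F.eval₂ (J : B →+* A) T‖ ≤
      K * (m * k * m) := by
  have hm0 : 0 ≤ m := (norm_nonneg _).trans (hm _ (γ.mem 0))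
  have hk0 : 0 ≤ k := (norm_nonneg _).trans (hk _ (γ.mem 0))
  have : CompactSpace Ω := isCompact_iff_compactSpace.1 hcomp
  let ι : B →ₐ[ℂ] C(Ω, B) × A := (constMapAlgHom Ω B).prod J
  let ev : Ω → C(Ω, B) × A →ₐ[ℂ] B := fun z => (evalAtAlgHom Ω B z).comp (AlgHom.fst ℂ _ _)
  let pr : C(Ω, B) × A →ₐ[ℂ] A := AlgHom.snd ℂ _ _
  have hev : ∀ z, Continuous (ev z) := fun z => (continuous_eval_const z).comp continuous_fst
  let Z : C(Ω, B) × A := (⟨fun z => algebraMap ℂ B z, (algebraMapCLM ℂ B).continuous.comp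
    continuous_subtype_val⟩, T)
  have hιc : Continuous ι := ContinuousMap.continuous_const'.prodMk hJc
  have hcom : ∀ b, Commute (ι b) Z := fun b =>
    Prod.ext (ContinuousMap.ext fun z => (Algebra.commutes (z : ℂ) b).symm) (hJ b)
  let Φ : B[X] →ₐ[ℂ] C(Ω, B) × A := eval₂AlgHom ι Z hcom
  have hΦ1 : ∀ (p : B[X]) (z : Ω), (Φ p).1 z = p.eval (algebraMap ℂ B z) := by
    intro p z
    have := hom_eval₂ p (ι : B →+* C(Ω, B) × A) (ev z : C(Ω, B) × A →+* B) Z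
    rw [← eval₂_id]
    exact this
  have hΦ2 : ∀ p : B[X], (Φ p).2 = p.eval₂ (J : B →+* A) T := fun p =>
    hom_eval₂ p (ι : B →+* C(Ω, B) × A) (pr : C(Ω, B) × A →+* A) Z
  let S : Subalgebra ℂ (C(Ω, B) × A) := Φ.range.topologicalClosure
  have hS : IsClosed (S : Set (C(Ω, B) × A)) := Subalgebra.isClosed_topologicalClosure _
  have hΦS : ∀ p, Φ p ∈ S := fun p => Subalgebra.le_topologicalClosure _ ⟨p, rfl⟩
  have hZS : Z ∈ S := by
    have : Φ X = Z := eval₂_X _ _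
    exact this ▸ hΦS X
  have hιS : ∀ b, ι b ∈ S := fun b => by
    have : Φ (C b) = ι b := eval₂_C _ _
    exact this ▸ hΦS (C b)
  have hbound : ∀ g ∈ S, ‖g.2‖ ≤ K * ‖g.1‖ := by
    refine closure_minimal (t := {g : C(Ω, B) × A | ‖g.2‖ ≤ K * ‖g.1‖}) ?_
      (isClosed_le continuous_snd.norm (continuous_const.mul continuous_fst.norm))
    rintro _ ⟨p, rfl⟩
    change ‖(Φ p).2‖ ≤ K * ‖(Φ p).1‖
    rw [hΦ2]
    refine hK p _ fun z hz => ?_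
    rw [← hΦ1 p ⟨z, hz⟩]
    exact ContinuousMap.norm_coe_le_norm _ _
  have hu : ∀ s ∈ Icc 0 r, ∀ t,
      IsUnit (algebraMap ℂ (C(Ω, B) × A) (γ.pt t) - (s : ℂ) • Z) := fun s hs t =>
    Prod.isUnit_iff.2 ⟨(ContinuousMap.isUnit_iff_forall_isUnit _).2 fun z => huB z z.2 s hs t,
      huA s hs t⟩
  have hur := hu r ⟨hr0, le_rfl⟩
  have hGS : γ.conjTransform ι F Z r ∈ S :=
    SupportedCurve.conjTransform_mem S hS hZS hιS hιc F hr0 hu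
  have hG2 : (γ.conjTransform ι F Z r).2 = γ.conjTransform J F T r :=
    SupportedCurve.map_conjTransform pr continuous_snd hιc F hur
  have hG1 : ‖(γ.conjTransform ι F Z r).1‖ ≤ k := by
    refine (ContinuousMap.norm_le _ hk0).2 fun z => ?_
    have h1 : (γ.conjTransform ι F Z r).1 z =
        γ.conjTransform (AlgHom.id ℂ B) F (algebraMap ℂ B z) r :=
      SupportedCurve.map_conjTransform (ev z) (hev z) hιc F hur
    rw [h1]
    exact hk z z.2
  have hF1 : ‖(Φ F).1‖ ≤ m := by
    refine (ContinuousMap.norm_le _ hm0).2 fun z => ?_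
    rw [hΦ1]
    exact hm z z.2
  have hfin := hbound _ (S.mul_mem (S.mul_mem (hΦS F) hGS) (hΦS F))
  rw [Prod.snd_mul, Prod.snd_mul, Prod.fst_mul, Prod.fst_mul, hΦ2, hG2] at hfin
  refine hfin.trans (mul_le_mul_of_nonneg_left ?_ hK0)
  exact (norm_mul_le _ _).trans (by gcongr; exact (norm_mul_le _ _).trans (by gcongr))

theorem IsOperatorSpectral.norm_mul_conjTransform_mul_le (hK : IsOperatorSpectral J T Ω K)
    (hK0 : 0 ≤ K) (hcomp : IsCompact Ω) (γ : SupportedCurve Ω) (hT : HalfPlaneRange T Ω)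
    (hJ : ∀ b, Commute (J b) T) (hΩ : ∀ r ∈ Icc (0 : ℝ) 1, ∀ z ∈ Ω, (r : ℂ) * z ∈ Ω)
    (F : (E →L[ℂ] E)[X]) {m : ℝ}
    (hm : ∀ z ∈ Ω, ‖F.eval (algebraMap ℂ (E →L[ℂ] E) z)‖ ≤ m) {r : ℝ} (hr0 : 0 ≤ r)
    (hr1 : r < 1) :
    ‖F.eval₂ (J : (E →L[ℂ] E) →+* (H →L[ℂ] H)) T *
      γ.conjTransform (J : (E →L[ℂ] E) →ₐ[ℂ] (H →L[ℂ] H)) F T r *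
      F.eval₂ (J : (E →L[ℂ] E) →+* (H →L[ℂ] H)) T‖ ≤ 3 * K * m ^ 3 := by
  have hz : ∀ z ∈ Ω, HalfPlaneRange (algebraMap ℂ (E →L[ℂ] E) z) Ω :=
    fun z => halfPlaneRange_algebraMap
  have key := norm_eval₂_mul_conjTransform_mul_eval₂_le (k := 3 * m)
    (J := (J : (E →L[ℂ] E) →ₐ[ℂ] (H →L[ℂ] H))) (continuous_starAlgHom J) hJ hcomp γ hK hK0 F
    hm hr0 (fun z h => (γ.resolventBound (hz z h) hr0 hr1).isUnit)
    (γ.resolventBound hT hr0 hr1).isUnit fun z h => by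
      have h2 := γ.norm_eval₂_add_star_conjTransform_le (hz z h) hr0 hr1
        (StarAlgHom.id ℂ (E →L[ℂ] E)) (fun b => (Algebra.commutes z b).symm) F hm
      have h3 : F.eval₂ ((StarAlgHom.id ℂ (E →L[ℂ] E)) : (E →L[ℂ] E) →+* (E →L[ℂ] E))
          ((r : ℂ) • algebraMap ℂ (E →L[ℂ] E) z) = F.eval (algebraMap ℂ (E →L[ℂ] E) (r * z)) := by
        rw [map_mul, ← Algebra.smul_def, ← eval₂_id]
        rfl
      rw [h3] at h2
      have h4 := hm _ (hΩ r ⟨hr0, hr1.le⟩ z h)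
      set G := γ.conjTransform (AlgHom.id ℂ (E →L[ℂ] E)) F (algebraMap ℂ (E →L[ℂ] E) z) r
      set Q := F.eval (algebraMap ℂ (E →L[ℂ] E) (r * z))
      have h5 : ‖Q + star G‖ ≤ 2 * m := h2
      calc ‖G‖ = ‖(Q + star G) - Q‖ := by rw [add_sub_cancel_left, norm_star]
        _ ≤ 2 * m + m := (norm_sub_le _ _).trans (add_le_add h5 h4)
        _ = 3 * m := by ring
  exact key.trans_eq (by ring)

theorem IsOperatorSpectral.norm_pow_three_le (hK : IsOperatorSpectral J T Ω K)
    (hK0 : 0 ≤ K) (hcomp : IsCompact Ω) (γ : SupportedCurve Ω) (hT : HalfPlaneRange T Ω)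
    (hJ : ∀ b, Commute (J b) T) (hΩ : ∀ r ∈ Icc (0 : ℝ) 1, ∀ z ∈ Ω, (r : ℂ) * z ∈ Ω)
    (F : (E →L[ℂ] E)[X]) {m : ℝ}
    (hm : ∀ z ∈ Ω, ‖F.eval (algebraMap ℂ (E →L[ℂ] E) z)‖ ≤ m) :
    ‖F.eval₂ (J : (E →L[ℂ] E) →+* (H →L[ℂ] H)) T‖ ^ 3 ≤ (2 * K ^ 2 + 3 * K) * m ^ 3 := by
  have hm0 : 0 ≤ m := (norm_nonneg _).trans (hm _ (γ.mem 0))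
  set A := F.eval₂ (J : (E →L[ℂ] E) →+* (H →L[ℂ] H)) T
  let Ar : ℝ → H →L[ℂ] H :=
    fun r => F.eval₂ (J : (E →L[ℂ] E) →+* (H →L[ℂ] H)) ((r : ℂ) • T)
  have hA : ‖A‖ ≤ K * m := hK F m hm
  have hcube : ‖A‖ ^ 3 ≤ ‖A * star A * A‖ := by
    have h1 : ‖star A * (A * star A * A)‖ = ‖A‖ ^ 4 := by
      have : star A * (A * star A * A) = star (star A * A) * (star A * A) := by
        simp only [star_mul, star_star, mul_assoc]
      rw [this, CStarRing.norm_star_mul_self, CStarRing.norm_star_mul_self]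
      ring
    have h2 : ‖A‖ ^ 4 ≤ ‖A‖ * ‖A * star A * A‖ := by
      rw [← h1]
      exact (norm_mul_le _ _).trans_eq (by rw [norm_star])
    rcases (norm_nonneg A).eq_or_lt with h0 | h0
    · rw [← h0]; simp
    · refine le_of_mul_le_mul_left ?_ h0
      refine le_trans (le_of_eq ?_) h2
      ring
  have hstep : ∀ r ∈ Ico (0 : ℝ) 1,
      ‖A‖ ^ 3 ≤ ‖A‖ ^ 2 * ‖A - Ar r‖ + (2 * K ^ 2 + 3 * K) * m ^ 3 := by
    intro r hr
    set G := γ.conjTransform (J : (E →L[ℂ] E) →ₐ[ℂ] (H →L[ℂ] H)) F T r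
    have h1 : ‖A * G * A‖ ≤ 3 * K * m ^ 3 :=
      hK.norm_mul_conjTransform_mul_le hK0 hcomp γ hT hJ hΩ F hm hr.1 hr.2
    have h2 : ‖Ar r + star G‖ ≤ 2 * m :=
      γ.norm_eval₂_add_star_conjTransform_le hT hr.1 hr.2 J hJ F hm
    have h3 : A * star A * A =
        A * star (A - Ar r) * A + A * star (Ar r + star G) * A - A * G * A := by
      simp only [star_sub, star_add, star_star]
      noncomm_ring
    have h4 : ∀ Y : H →L[ℂ] H, ‖A * star Y * A‖ ≤ ‖A‖ ^ 2 * ‖Y‖ := fun Y =>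
      calc ‖A * star Y * A‖ ≤ ‖A‖ * ‖star Y‖ * ‖A‖ :=
            (norm_mul_le _ _).trans (by gcongr; exact norm_mul_le _ _)
        _ = ‖A‖ ^ 2 * ‖Y‖ := by rw [norm_star]; ring
    have h5 : ‖A‖ ^ 2 * ‖Ar r + star G‖ ≤ (K * m) ^ 2 * (2 * m) := by gcongr
    calc ‖A‖ ^ 3 ≤ ‖A * star A * A‖ := hcube
      _ ≤ ‖A‖ ^ 2 * ‖A - Ar r‖ + (K * m) ^ 2 * (2 * m) + 3 * K * m ^ 3 := by
          rw [h3]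
          refine (norm_sub_le _ _).trans (add_le_add ((norm_add_le _ _).trans
            (add_le_add (h4 _) ((h4 _).trans h5))) h1)
      _ = _ := by ring
  have hArc : Continuous Ar := by
    have h := F.continuous_eval₂ (J : (E →L[ℂ] E) →+* (H →L[ℂ] H))
    exact h.comp (Complex.continuous_ofReal.smul continuous_const)
  have hAr1 : Ar 1 = A := by simp [Ar, A]
  have hlim : Tendsto (fun r => ‖A‖ ^ 2 * ‖A - Ar r‖ + (2 * K ^ 2 + 3 * K) * m ^ 3)
      (𝓝[Ico 0 1] 1) (𝓝 ((2 * K ^ 2 + 3 * K) * m ^ 3)) := by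
    refine Tendsto.mono_left (Continuous.tendsto' (by fun_prop) _ _ ?_) nhdsWithin_le_nhds
    simp [hAr1]
  have : (𝓝[Ico (0 : ℝ) 1] 1).NeBot := by
    rw [← mem_closure_iff_nhdsWithin_neBot, closure_Ico zero_ne_one]
    exact right_mem_Icc.2 zero_le_one
  exact ge_of_tendsto hlim (eventually_mem_nhdsWithin.mono hstep)

theorem exists_isOperatorSpectral (γ : SupportedCurve Ω) {r : ℝ} (hr0 : 0 < r) (hr1 : r < 1)
    (hT : HalfPlaneRange (((r⁻¹ : ℝ) : ℂ) • T) Ω) : ∃ K, 0 ≤ K ∧ IsOperatorSpectral J T Ω K := by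
  set T' := ((r⁻¹ : ℝ) : ℂ) • T
  have hTT' : (r : ℂ) • T' = T := by
    rw [smul_smul, ← Complex.ofReal_mul, mul_inv_cancel₀ hr0.ne', Complex.ofReal_one, one_smul]
  have hR := γ.resolventBound hT hr0.le hr1
  set M := ((1 - r) * γ.gap)⁻¹
  have hM : 0 ≤ M := (norm_nonneg _).trans (hR.norm_le r hR.right_mem 0)
  set c := ∫ t in (0 : ℝ)..2 * Real.pi, ‖γ.vel t‖
  have hc : 0 ≤ c := intervalIntegral.integral_nonneg Real.two_pi_pos.le fun t _ => norm_nonneg _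
  refine ⟨‖(2 * Real.pi * Complex.I : ℂ)⁻¹‖ * (M * c), by positivity, fun F m hm => ?_⟩
  have hm0 : 0 ≤ m := (norm_nonneg _).trans (hm _ (γ.mem 0))
  have h1 := hR.integral_eval (J : (E →L[ℂ] E) →ₐ[ℂ] (H →L[ℂ] H)) F
  rw [hTT'] at h1
  have h2 : F.eval₂ (J : (E →L[ℂ] E) →+* (H →L[ℂ] H)) T = (2 * Real.pi * Complex.I : ℂ)⁻¹ •
      ∫ t in (0 : ℝ)..2 * Real.pi, γ.vel t •
        ((J : (E →L[ℂ] E) →ₐ[ℂ] (H →L[ℂ] H)) (F.eval (algebraMap ℂ (E →L[ℂ] E) (γ.pt t))) *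
          γ.res T' r t) :=
    (eq_inv_smul_iff₀ Complex.two_pi_I_ne_zero).2 h1.symm
  rw [h2, norm_smul]
  have h3 := γ.norm_integral_vel_smul_le (C := m * M) (f := fun t =>
    ((J : (E →L[ℂ] E) →ₐ[ℂ] (H →L[ℂ] H)) (F.eval (algebraMap ℂ (E →L[ℂ] E) (γ.pt t))) *
          γ.res T' r t)) fun t => by
    refine (norm_mul_le _ _).trans ?_
    gcongr
    · exact (NonUnitalStarAlgHom.norm_apply_le J _).trans (hm _ (γ.mem t))
    · exact hR.norm_le r hR.right_mem t
  calc _ ≤ ‖(2 * Real.pi * Complex.I : ℂ)⁻¹‖ * (m * M * c) := by gcongr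
    _ = _ := by ring

theorem isOperatorSpectral_three (hcomp : IsCompact Ω) (γ : SupportedCurve Ω)
    (hJ : ∀ b, Commute (J b) T) (hΩ : ∀ r ∈ Icc (0 : ℝ) 1, ∀ z ∈ Ω, (r : ℂ) * z ∈ Ω)
    (hT : HalfPlaneRange T Ω) {r : ℝ} (hr0 : 0 < r) (hr1 : r < 1)
    (hT' : HalfPlaneRange (((r⁻¹ : ℝ) : ℂ) • T) Ω) : IsOperatorSpectral J T Ω 3 := by
  let S := {K : ℝ | 0 ≤ K ∧ IsOperatorSpectral J T Ω K}
  have hne : S.Nonempty := exists_isOperatorSpectral γ hr0 hr1 hT'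
  have hbdd : BddBelow S := ⟨0, fun K hK => hK.1⟩
  have hclosed : IsClosed S := by
    have hS : S = Ici 0 ∩ ⋂ (F : (E →L[ℂ] E)[X]) (m : ℝ)
        (_ : ∀ z ∈ Ω, ‖F.eval (algebraMap ℂ (E →L[ℂ] E) z)‖ ≤ m),
        {K | ‖F.eval₂ (J : (E →L[ℂ] E) →+* (H →L[ℂ] H)) T‖ ≤ K * m} := by
      ext K
      simp only [mem_inter_iff, mem_iInter]
      rfl
    rw [hS]
    refine isClosed_Ici.inter ?_
    exact isClosed_iInter fun F => isClosed_iInter fun m => isClosed_iInter fun _ =>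
      isClosed_le continuous_const (by fun_prop)
  obtain ⟨hK0, hK⟩ := hclosed.csInf_mem hne hbdd
  set K := sInf S
  set L := 2 * K ^ 2 + 3 * K
  have hL0 : 0 ≤ L := by positivity
  have hroot : (L ^ (3⁻¹ : ℝ)) ^ 3 = L := by
    rw [← Real.rpow_natCast, ← Real.rpow_mul hL0]
    norm_num
  have hmem : L ^ (3⁻¹ : ℝ) ∈ S := by
    refine ⟨by positivity, fun F m hm => ?_⟩
    have hm0 : 0 ≤ m := (norm_nonneg _).trans (hm _ (γ.mem 0))
    refine le_of_pow_le_pow_left₀ three_ne_zero (by positivity) ?_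
    rw [mul_pow, hroot]
    exact hK.norm_pow_three_le hK0 hcomp γ hT hJ hΩ F hm
  have hKL : K ^ 3 ≤ L := by
    rw [← hroot]
    exact pow_le_pow_left₀ hK0 (csInf_le hbdd hmem) 3
  have hK3 : K ≤ 3 := by
    by_contra! h
    have : 0 < K * (K - 3) * (K + 1) := by
      have := sub_pos.2 h
      positivity
    simp only [L] at hKL
    nlinarith
  intro F m hm
  have hm0 : 0 ≤ m := (norm_nonneg _).trans (hm _ (γ.mem 0))
  exact (hK F m hm).trans (by gcongr)

end Spectral

section NumericalRange

variable {H : Type*} [NormedAddCommGroup H] [InnerProductSpace ℂ H]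

theorem inner_apply_smul_smul (T : H →L[ℂ] H) (c : ℂ) (x : H) :
    ⟪c • x, T (c • x)⟫_ℂ = ((‖c‖ ^ 2 : ℝ) : ℂ) * ⟪x, T x⟫_ℂ := by
  rw [map_smul, inner_smul_left, inner_smul_right, ← mul_assoc, Complex.conj_mul']
  push_cast
  rfl

theorem exists_mem_numRange_inner_eq (T : H →L[ℂ] H) {x : H} (hx : x ≠ 0) :
    ∃ z ∈ numRange T, ⟪x, T x⟫_ℂ = ((‖x‖ ^ 2 : ℝ) : ℂ) * z := by
  have hn : ‖x‖ ≠ 0 := norm_ne_zero_iff.2 hx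
  refine ⟨_, ⟨((‖x‖⁻¹ : ℝ) : ℂ) • x, ?_, rfl⟩, ?_⟩
  · rw [norm_smul, Complex.norm_real, norm_inv, norm_norm, inv_mul_cancel₀ hn]
  · rw [inner_apply_smul_smul, ← mul_assoc, ← Complex.ofReal_mul, Complex.norm_real, norm_inv,
      norm_norm, ← mul_pow, mul_inv_cancel₀ hn, one_pow, Complex.ofReal_one, one_mul]

theorem norm_le_of_mem_numRange {T : H →L[ℂ] H} {z : ℂ} (hz : z ∈ numRange T) : ‖z‖ ≤ ‖T‖ := by
  obtain ⟨x, hx, rfl⟩ := hz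
  refine (norm_inner_le_norm _ _).trans ?_
  rw [hx, one_mul]
  exact T.unit_le_opNorm x hx.le

theorem numRadius_le_norm (T : H →L[ℂ] H) : numRadius T ≤ ‖T‖ := by
  refine Real.sSup_le ?_ (norm_nonneg _)
  rintro _ ⟨x, hx, rfl⟩
  exact norm_le_of_mem_numRange ⟨x, hx, rfl⟩

theorem numRange_smul_sub (T : H →L[ℂ] H) (a c : ℂ) :
    numRange (a • (T - c • (1 : H →L[ℂ] H))) = (fun z => a * (z - c)) '' numRange T := by
  have key : ∀ x : H, ‖x‖ = 1 →
      ⟪x, (a • (T - c • (1 : H →L[ℂ] H))) x⟫_ℂ = a * (⟪x, T x⟫_ℂ - c) := by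
    intro x hx
    rw [smul_apply, sub_apply, smul_apply, one_apply_eq_self, inner_smul_right, inner_sub_right,
      inner_smul_right, inner_self_eq_norm_sq_to_K, hx]
    simp
  ext z
  constructor
  · rintro ⟨x, hx, rfl⟩
    exact ⟨_, ⟨x, hx, rfl⟩, (key x hx).symm⟩
  · rintro ⟨_, ⟨x, hx, rfl⟩, rfl⟩
    exact ⟨x, hx, (key x hx).symm⟩

theorem ofReal_mem_numRange {T : H →L[ℂ] H} (h0 : (0 : ℂ) ∈ numRange T)
    (h1 : (1 : ℂ) ∈ numRange T) {t : ℝ} (ht : t ∈ Icc (0 : ℝ) 1) : (t : ℂ) ∈ numRange T := by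
  obtain ⟨x, hx, hx0⟩ := h0
  obtain ⟨y, hy, hy1⟩ := h1
  obtain ⟨c, hc, hcim⟩ : ∃ c : ℂ, ‖c‖ = 1 ∧
      (c * ⟪x, T y⟫_ℂ + conj c * ⟪y, T x⟫_ℂ).im = 0 := by
    set d := ⟪x, T y⟫_ℂ - conj ⟪y, T x⟫_ℂ
    obtain ⟨c, hc, hcd⟩ : ∃ c : ℂ, ‖c‖ = 1 ∧ (c * d).im = 0 := by
      rcases eq_or_ne d 0 with h | h
      · exact ⟨1, norm_one, by simp [h]⟩
      · have hn : ‖d‖ ≠ 0 := norm_ne_zero_iff.2 h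
        refine ⟨conj d / ‖d‖, ?_, ?_⟩
        · rw [norm_div, Complex.norm_conj, Complex.norm_real, norm_norm, div_self hn]
        · rw [div_mul_eq_mul_div, Complex.conj_mul', ← Complex.ofReal_pow, ← Complex.ofReal_div,
            Complex.ofReal_im]
    refine ⟨c, hc, ?_⟩
    rw [← hcd]
    simp only [d, Complex.add_im, Complex.mul_im, Complex.conj_re, Complex.conj_im,
      Complex.sub_re, Complex.sub_im]
    ring
  let u : ℝ → H := fun s => ((1 - s : ℝ) : ℂ) • x + ((s : ℂ) * c) • y
  have hu : Continuous u := by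
    have h1 : Continuous fun s : ℝ => ((1 - s : ℝ) : ℂ) :=
      Complex.continuous_ofReal.comp (continuous_const.sub continuous_id)
    exact (h1.smul continuous_const).add
      ((Complex.continuous_ofReal.mul continuous_const).smul continuous_const)
  have hq : ∀ s, ⟪u s, T (u s)⟫_ℂ = ((s ^ 2 : ℝ) : ℂ) + ((s * (1 - s) : ℝ) : ℂ) *
      (c * ⟪x, T y⟫_ℂ + conj c * ⟪y, T x⟫_ℂ) := by
    intro s
    have hcc : conj c * c = 1 := by rw [Complex.conj_mul', hc]; simp
    simp only [u, map_add, map_smul, inner_add_left, inner_add_right, inner_smul_left,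
      inner_smul_right, ← hx0, ← hy1, map_mul, Complex.conj_ofReal]
    push_cast
    linear_combination (s : ℂ) ^ 2 * hcc
  have him : ∀ s, (⟪u s, T (u s)⟫_ℂ).im = 0 := by
    intro s
    rw [hq, Complex.add_im, Complex.ofReal_im, Complex.im_ofReal_mul, hcim, mul_zero, add_zero]
  let f : ℝ → ℝ := fun s => (⟪u s, T (u s)⟫_ℂ).re - t * ‖u s‖ ^ 2
  have hf : Continuous f := by
    have := Complex.continuous_re.comp (hu.inner (𝕜 := ℂ) (T.continuous.comp hu))
    exact this.sub (continuous_const.mul (hu.norm.pow 2))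
  have hf0 : f 0 = -t := by
    have h1 : u 0 = x := by simp [u]
    simp only [f, h1, hx, ← hx0]
    simp
  have hf1 : f 1 = 1 - t := by
    have h1 : ‖u 1‖ = 1 := by simp [u, norm_smul, hc, hy]
    simp only [f, h1, hq]
    simp
  obtain ⟨s, -, hs⟩ : (0 : ℝ) ∈ f '' Icc 0 1 :=
    intermediate_value_Icc zero_le_one hf.continuousOn
      ⟨by rw [hf0]; linarith [ht.1], by rw [hf1]; linarith [ht.2]⟩
  have hval : ⟪u s, T (u s)⟫_ℂ = ((‖u s‖ ^ 2 : ℝ) : ℂ) * t := by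
    refine Complex.ext ?_ ?_
    · rw [← Complex.ofReal_mul, Complex.ofReal_re]
      simp only [f] at hs
      linarith
    · rw [him, ← Complex.ofReal_mul, Complex.ofReal_im]
  have hus : u s ≠ 0 := by
    intro h
    have h1 : ((1 - s : ℝ) : ℂ) • x = (-((s : ℂ) * c)) • y := by
      rw [neg_smul]
      exact eq_neg_of_add_eq_zero_left h
    have h2 : |1 - s| = |s| := by
      have := congrArg norm h1
      rwa [norm_smul, norm_smul, hx, hy, norm_neg, norm_mul, hc, Complex.norm_real,
        Complex.norm_real, mul_one, mul_one, mul_one] at this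
    have h3 := inner_apply_smul_smul T ((1 - s : ℝ) : ℂ) x
    rw [h1, inner_apply_smul_smul, ← hx0, ← hy1, mul_zero, mul_one, norm_neg, norm_mul, hc,
      mul_one, Complex.norm_real] at h3
    have h4 : s = 0 := by simpa using h3
    simp [h4] at h2
  obtain ⟨z, hz, hz'⟩ := exists_mem_numRange_inner_eq T hus
  rw [hval] at hz'
  have hne : ((‖u s‖ ^ 2 : ℝ) : ℂ) ≠ 0 :=
    Complex.ofReal_ne_zero.2 (pow_ne_zero 2 (norm_ne_zero_iff.2 hus))
  rwa [mul_left_cancel₀ hne hz']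

/-- The Toeplitz-Hausdorff theorem. -/
theorem convex_numRange (T : H →L[ℂ] H) : Convex ℝ (numRange T) := by
  refine convex_iff_segment_subset.2 fun a ha b hb => ?_
  rw [segment_eq_image_lineMap]
  rintro _ ⟨t, ht, rfl⟩
  rcases eq_or_ne a b with rfl | hab
  · rwa [AffineMap.lineMap_same_apply]
  have hba : b - a ≠ 0 := sub_ne_zero.2 hab.symm
  have hr := numRange_smul_sub T (b - a)⁻¹ a
  have h := ofReal_mem_numRange (T := (b - a)⁻¹ • (T - a • (1 : H →L[ℂ] H)))
    (hr ▸ ⟨a, ha, by simp⟩) (hr ▸ ⟨b, hb, inv_mul_cancel₀ hba⟩) ht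
  rw [hr] at h
  obtain ⟨z, hz, hzt⟩ := h
  have : z = AffineMap.lineMap a b t := by
    rw [AffineMap.lineMap_apply_module', Complex.real_smul, ← hzt]
    field_simp
    ring
  rwa [← this]

end NumericalRange

section MatrixPolynomial

open Matrix

variable {H : Type*} [NormedAddCommGroup H] [InnerProductSpace ℂ H] {n : ℕ}

theorem matPolyEval_apply (T : H →L[ℂ] H) (F : Matrix (Fin n) (Fin n) ℂ[X])
    (x : PiLp 2 fun _ : Fin n => H) (i : Fin n) :
    matPolyEval T F x i = ∑ j, aeval T (F i j) (x j) := by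
  simp [matPolyEval]

theorem matPolyEval_add (T : H →L[ℂ] H) (F G : Matrix (Fin n) (Fin n) ℂ[X]) :
    matPolyEval T (F + G) = matPolyEval T F + matPolyEval T G := by
  ext x i
  simp [matPolyEval_apply, Finset.sum_add_distrib]

theorem matPolyEval_mul (T : H →L[ℂ] H) (F G : Matrix (Fin n) (Fin n) ℂ[X]) :
    matPolyEval T (F * G) = matPolyEval T F * matPolyEval T G := by
  ext x i
  simp only [mul_apply_eq_comp, matPolyEval_apply, Matrix.mul_apply, map_sum, map_mul,
    _root_.sum_apply]
  exact Finset.sum_comm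

theorem matPolyEval_diagonal (T : H →L[ℂ] H) (p : ℂ[X]) (x : PiLp 2 fun _ : Fin n => H)
    (i : Fin n) : matPolyEval T (diagonal fun _ => p) x i = aeval T p (x i) := by
  rw [matPolyEval_apply, Finset.sum_eq_single i]
  · rw [diagonal_apply_eq]
  · intro j _ hj
    rw [diagonal_apply_ne _ hj.symm, map_zero, _root_.zero_apply]
  · simp

theorem matPolyEval_one (T : H →L[ℂ] H) :
    matPolyEval T (1 : Matrix (Fin n) (Fin n) ℂ[X]) = 1 := by
  ext x i
  rw [← diagonal_one, matPolyEval_diagonal, map_one]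
  rfl

theorem matPolyEval_pow (T : H →L[ℂ] H) (F : Matrix (Fin n) (Fin n) ℂ[X]) (k : ℕ) :
    matPolyEval T (F ^ k) = matPolyEval T F ^ k := by
  induction k with
  | zero => rw [pow_zero, pow_zero, matPolyEval_one]
  | succ k ih => rw [pow_succ, pow_succ, matPolyEval_mul, ih]

theorem matPolyEval_map_C_apply (T : H →L[ℂ] H) (A : Matrix (Fin n) (Fin n) ℂ)
    (x : PiLp 2 fun _ : Fin n => H) (i : Fin n) :
    matPolyEval T (A.map C) x i = ∑ j, A i j • x j := by
  simp [matPolyEval_apply, Algebra.algebraMap_eq_smul_one]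

theorem halfPlaneRange_smul_matPolyEval_diagonal {T : H →L[ℂ] H} {a : ℂ} {Ω : Set ℂ}
    (h : ∀ z ∈ numRange T, a * z ∈ Ω) :
    HalfPlaneRange (a • matPolyEval T (diagonal fun _ : Fin n => X)) Ω := by
  intro ν c hν x
  have key : ∀ y : H, (conj ν * (a * ⟪y, T y⟫_ℂ)).re ≤ c * ‖y‖ ^ 2 := by
    intro y
    rcases eq_or_ne y 0 with rfl | hy
    · simp
    · obtain ⟨z, hz, hz'⟩ := exists_mem_numRange_inner_eq T hy
      have h1 := mul_le_mul_of_nonneg_left (hν _ (h z hz)) (sq_nonneg ‖y‖)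
      rw [hz', mul_left_comm a, mul_left_comm, Complex.re_ofReal_mul]
      linarith
  rw [_root_.smul_apply, inner_smul_right, PiLp.inner_apply, PiLp.norm_sq_eq_of_L2, Finset.mul_sum,
    Finset.mul_sum, Finset.mul_sum, Complex.re_sum]
  refine Finset.sum_le_sum fun i _ => ?_
  rw [matPolyEval_diagonal, aeval_X]
  exact key _

theorem continuous_norm_toEuclideanCLM_map_eval (F : Matrix (Fin n) (Fin n) ℂ[X]) :
    Continuous fun z => ‖toEuclideanCLM (𝕜 := ℂ) (F.map (eval z))‖ := by
  have h1 : Continuous fun z => F.map (eval z) :=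
    continuous_matrix fun i j => (F i j).continuous
  have h2 : Continuous (toEuclideanCLM (n := Fin n) (𝕜 := ℂ)) :=
    LinearMap.continuous_of_finiteDimensional
      (toEuclideanCLM (n := Fin n) (𝕜 := ℂ)).toAlgEquiv.toLinearMap
  exact (h2.comp h1).norm

theorem norm_le_matPolyNorm_of_mem_closure {T : H →L[ℂ] H} (F : Matrix (Fin n) (Fin n) ℂ[X])
    {z : ℂ} (hz : z ∈ closure (numRange T)) :
    ‖toEuclideanCLM (𝕜 := ℂ) (F.map (eval z))‖ ≤ matPolyNorm (numRange T) F := by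
  have hc := continuous_norm_toEuclideanCLM_map_eval F
  refine closure_minimal (t := {z | ‖toEuclideanCLM (𝕜 := ℂ) (F.map (eval z))‖ ≤
    matPolyNorm (numRange T) F}) (fun w hw => ?_) (isClosed_le hc continuous_const) hz
  obtain ⟨R, hR⟩ := (isCompact_closedBall (0 : ℂ) ‖T‖).bddAbove_image hc.continuousOn
  refine le_csSup ⟨R, ?_⟩ ⟨w, hw, rfl⟩
  rintro _ ⟨v, hv, rfl⟩
  exact hR ⟨v, mem_closedBall_zero_iff.2 (norm_le_of_mem_numRange hv), rfl⟩

variable [CompleteSpace H]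

/-- Scalar matrices acting on the direct sum `Hⁿ`. -/
def matrixAction (H : Type*) [NormedAddCommGroup H] [InnerProductSpace ℂ H] [CompleteSpace H]
    (n : ℕ) : Matrix (Fin n) (Fin n) ℂ →⋆ₐ[ℂ]
      ((PiLp 2 fun _ : Fin n => H) →L[ℂ] (PiLp 2 fun _ : Fin n => H)) where
  toFun A := matPolyEval 0 (A.map C)
  map_one' := by rw [Matrix.map_one _ C_0 C_1, matPolyEval_one]
  map_mul' A B := by rw [Matrix.map_mul, matPolyEval_mul]
  map_zero' := by ext; simp [matPolyEval_apply]
  map_add' A B := by rw [Matrix.map_add _ (fun _ _ => C_add), matPolyEval_add]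
  commutes' c := by
    ext x i
    rw [matPolyEval_map_C_apply, algebraMap_eq_diagonal, Finset.sum_eq_single i]
    · simp [Algebra.algebraMap_eq_smul_one]
    · intro j _ hj
      rw [diagonal_apply_ne _ hj.symm, zero_smul]
    · simp
  map_star' A := by
    rw [star_eq_adjoint]
    refine (eq_adjoint_iff _ _).2 fun x y => ?_
    simp only [PiLp.inner_apply, matPolyEval_map_C_apply, sum_inner, inner_sum, inner_smul_left,
      inner_smul_right, star_apply, Complex.star_def, Complex.conj_conj]
    exact Finset.sum_comm

theorem matrixAction_apply (T : H →L[ℂ] H) (A : Matrix (Fin n) (Fin n) ℂ) :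
    matrixAction H n A = matPolyEval T (A.map C) := by
  ext x i
  rw [matPolyEval_map_C_apply]
  exact matPolyEval_map_C_apply 0 A x i

theorem commute_matrixAction (T : H →L[ℂ] H) (A : Matrix (Fin n) (Fin n) ℂ) :
    Commute (matrixAction H n A) (matPolyEval T (diagonal fun _ => X)) := by
  rw [matrixAction_apply T, Commute, SemiconjBy, ← matPolyEval_mul, ← matPolyEval_mul]
  congr 1
  exact (Matrix.scalar_commute X (fun _ => Commute.all _ _) _).eq.symm

theorem eval₂_matrixAction (T : H →L[ℂ] H) (P : (Matrix (Fin n) (Fin n) ℂ)[X]) :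
    P.eval₂ (matrixAction H n : Matrix (Fin n) (Fin n) ℂ →+* _)
      (matPolyEval T (diagonal fun _ => X)) = matPolyEval T (matPolyEquiv.symm P) := by
  induction P using Polynomial.induction_on' with
  | add p q hp hq => rw [eval₂_add, hp, hq, map_add, matPolyEval_add]
  | monomial k A =>
    rw [eval₂_monomial, ← C_mul_X_pow_eq_monomial, map_mul, map_pow, matPolyEquiv_symm_C,
      matPolyEquiv_symm_X, matPolyEval_mul, matPolyEval_pow]
    congr 1
    exact matrixAction_apply T A

theorem norm_matPolyEval_le_of_isCompact {T : H →L[ℂ] H} {Ω : Set ℂ} (hconv : Convex ℝ Ω)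
    (hcomp : IsCompact Ω) (h0 : (0 : ℂ) ∈ interior Ω) (hT : numRange T ⊆ Ω) {r : ℝ} (hr0 : 0 < r)
    (hr1 : r < 1) (hrT : ∀ z ∈ numRange T, ((r⁻¹ : ℝ) : ℂ) * z ∈ Ω)
    (F : Matrix (Fin n) (Fin n) ℂ[X]) {m : ℝ}
    (hm : ∀ z ∈ Ω, ‖toEuclideanCLM (𝕜 := ℂ) (F.map (eval z))‖ ≤ m) :
    ‖matPolyEval T F‖ ≤ 3 * m := by
  obtain ⟨γ⟩ := SupportedCurve.exists_of_convex hconv hcomp h0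
  let τ := toEuclideanCLM (n := Fin n) (𝕜 := ℂ)
  let J := (matrixAction H n).comp τ.symm.toStarAlgHom
  have hD : HalfPlaneRange (matPolyEval T (diagonal fun _ : Fin n => X)) Ω := by
    have h := halfPlaneRange_smul_matPolyEval_diagonal (n := n) (a := 1) (Ω := Ω) (T := T)
      fun z hz => by rw [one_mul]; exact hT hz
    rwa [one_smul] at h
  have key := isOperatorSpectral_three (J := J)
    (T := matPolyEval T (diagonal fun _ : Fin n => X)) hcomp γ
    (fun b => commute_matrixAction T _)
    (fun s hs z hz => by
      rw [← Complex.real_smul]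
      exact hconv.smul_mem_of_zero_mem (interior_subset h0) hz hs)
    hD hr0 hr1
    (halfPlaneRange_smul_matPolyEval_diagonal hrT)
  let τ' : Matrix (Fin n) (Fin n) ℂ →+*
      (EuclideanSpace ℂ (Fin n) →L[ℂ] EuclideanSpace ℂ (Fin n)) :=
    τ.toAlgEquiv.toRingEquiv.toRingHom
  let P := (matPolyEquiv F).map τ'
  have hP : P.eval₂ (J : _ →+* _) (matPolyEval T (diagonal fun _ : Fin n => X)) =
      matPolyEval T F := by
    have h1 := eval₂_matrixAction T (matPolyEquiv F)
    rw [AlgEquiv.symm_apply_apply] at h1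
    rw [← h1, eval₂_map]
    congr 1
    ext1 A
    exact congrArg (matrixAction H n) (τ.symm_apply_apply A)
  have h := key P m fun z hz => by
    have h1 := Polynomial.eval_map_apply (f := τ')
      (p := matPolyEquiv F) (scalar (Fin n) z)
    have h2 : τ' (scalar (Fin n) z) =
        algebraMap ℂ _ z := τ.toAlgEquiv.commutes z
    rw [h2, matPolyEquiv_eval_eq_map] at h1
    refine (congrArg norm h1).trans_le (hm z hz)
  rwa [hP] at h

theorem norm_matPolyEval_le_of_zero_mem {T : H →L[ℂ] H} (h0 : (0 : ℂ) ∈ numRange T)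
    (F : Matrix (Fin n) (Fin n) ℂ[X]) :
    ‖matPolyEval T F‖ ≤ 3 * matPolyNorm (numRange T) F := by
  refine le_of_forall_pos_le_add fun ε hε => ?_
  set m := matPolyNorm (numRange T) F
  have hcomp : IsCompact (closure (numRange T)) :=
    (isCompact_closedBall (0 : ℂ) ‖T‖).of_isClosed_subset isClosed_closure
      (closure_minimal (fun z hz => mem_closedBall_zero_iff.2 (norm_le_of_mem_numRange hz))
        Metric.isClosed_closedBall)
  obtain ⟨δ, hδ, hsub⟩ := hcomp.exists_cthickening_subset_open
    (isOpen_lt (continuous_norm_toEuclideanCLM_map_eval F) continuous_const)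
    (fun z hz => (norm_le_matPolyNorm_of_mem_closure F hz).trans_lt
      (lt_add_of_pos_right m (div_pos hε three_pos)))
  rw [Metric.cthickening_closure] at hsub
  have hT : numRange T ⊆ Metric.cthickening δ (numRange T) := Metric.self_subset_cthickening _
  have hint : (0 : ℂ) ∈ interior (Metric.cthickening δ (numRange T)) :=
    Metric.isOpen_thickening.subset_interior_iff.2 (Metric.thickening_subset_cthickening δ _)
      (Metric.self_subset_thickening hδ _ h0)
  have hcomp' : IsCompact (Metric.cthickening δ (numRange T)) := by
    rw [← Metric.cthickening_closure]
    exact hcomp.cthickening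
  have hs : 0 < δ / (‖T‖ + 1) := by positivity
  have h := norm_matPolyEval_le_of_isCompact ((convex_numRange T).cthickening δ) hcomp' hint hT
    (r := (1 + δ / (‖T‖ + 1))⁻¹) (by positivity) (inv_lt_one_of_one_lt₀ (by linarith))
    (fun z hz => by
      refine Metric.mem_cthickening_of_dist_le _ z _ _ hz ?_
      have hz' := norm_le_of_mem_numRange hz
      rw [inv_inv, dist_eq_norm, Complex.ofReal_add, Complex.ofReal_one, add_mul, one_mul,
        add_sub_cancel_left, norm_mul, Complex.norm_real, Real.norm_of_nonneg hs.le]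
      calc δ / (‖T‖ + 1) * ‖z‖ ≤ δ / (‖T‖ + 1) * (‖T‖ + 1) := by gcongr; linarith
        _ = δ := by field_simp)
    F (fun z hz => (hsub hz).le)
  exact h.trans_eq (by ring)

theorem norm_matPolyEval_le {T : H →L[ℂ] H} (hT : (numRange T).Nonempty)
    (F : Matrix (Fin n) (Fin n) ℂ[X]) :
    ‖matPolyEval T F‖ ≤ 3 * matPolyNorm (numRange T) F := by
  obtain ⟨c, hc⟩ := hT
  have hr := numRange_smul_sub T 1 c
  simp only [one_smul, one_mul] at hr
  have h := norm_matPolyEval_le_of_zero_mem (T := T - c • (1 : H →L[ℂ] H))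
    (hr ▸ ⟨c, hc, sub_self c⟩) (F.map fun p => p.comp (X + C c))
  have h1 : matPolyEval (T - c • (1 : H →L[ℂ] H)) (F.map fun p => p.comp (X + C c)) =
      matPolyEval T F := by
    ext x i
    simp [matPolyEval_apply, aeval_comp, Algebra.algebraMap_eq_smul_one]
  have h2 : matPolyNorm (numRange (T - c • (1 : H →L[ℂ] H))) (F.map fun p => p.comp (X + C c)) =
      matPolyNorm (numRange T) F := by
    have h3 : ∀ z, (F.map fun p => p.comp (X + C c)).map (eval (z - c)) = F.map (eval z) := by
      intro z
      ext i j
      simp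
    rw [matPolyNorm, matPolyNorm, hr]
    simp only [exists_mem_image, h3]
  rwa [h1, h2] at h

theorem numRadius_matPolyEval_le (T : H →L[ℂ] H) (F : Matrix (Fin n) (Fin n) ℂ[X]) :
    numRadius (matPolyEval T F) ≤ 3 * matPolyNorm (numRange T) F := by
  rcases (numRange T).eq_empty_or_nonempty with hT | hT
  · have hsub : ∀ x : H, x = 0 := by
      by_contra! ⟨x, hx⟩
      obtain ⟨z, hz, -⟩ := exists_mem_numRange_inner_eq T hx
      simp [hT] at hz
    have h1 : matPolyNorm (numRange T) F = 0 := by simp [matPolyNorm, hT]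
    rw [h1, mul_zero]
    refine Real.sSup_le ?_ le_rfl
    rintro _ ⟨x, -, rfl⟩
    rw [show x = 0 from PiLp.ext fun i => hsub _]
    simp
  · exact (numRadius_le_norm _).trans (norm_matPolyEval_le hT F)

end MatrixPolynomial

end OperatorSpectralSets

/-- There is a universal constant `M ≤ 5.6` such that `w(F(T)) ≤ M·‖F‖_{W(T)}`
for every operator `T` and every matrix polynomial `F`. -/
theorem exists_universal_numRadius_bound :
    ∃ M : ℝ, M ≤ 5.6 ∧
      ∀ (H : Type u) [NormedAddCommGroup H] [InnerProductSpace ℂ H] [CompleteSpace H]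
        (T : H →L[ℂ] H) (n : ℕ), 1 ≤ n →
        ∀ F : Matrix (Fin n) (Fin n) (Polynomial ℂ),
          numRadius (matPolyEval T F) ≤ M * matPolyNorm (numRange T) F := by
  refine ⟨3, by norm_num, ?_⟩
  intro H _ _ _ T n _ F
  exact numRadius_matPolyEval_le T F

end
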